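/- Weighted factorization formula: Let W be irreducible and let g ∈ W be a regular element of order d whose reflection length satisfies d · l_R(g) = |R| + |A| (this holds in particular when d equals the largest fundamental degree of W). Then for every orbit C one has n_C(g) = e_C·ω_C/d, and for every function assigning a nonnegative integer l(C) to each W-orbit C of reflecting hyperplanes, with N := Σ_C l(C), the number of tuples (t_1, …, t_N) ∈ R^N with t_1⋯t_N = g and, for each orbit C, exactly l(C) indices i with t_i ∈ C^ref, equals (N! / (|W| · ∏_C l(C)!)) · ∏_C [ Σ_{k=0}^{e_C ω_C/d} (−1)^k · binom(e_C ω_C/d, k) · (ω_C(e_C − 1) − k·d)^{l(C)} ]. -/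

import Mathlib

open scoped BigOperators

noncomputable section

/-- `χ` is an irreducible complex character of the group `G`. -/
def IsIrredChar (G : Type*) [Group G] (χ : G → ℂ) : Prop :=
  ∃ (n : ℕ) (ρ : Representation ℂ G (Fin n → ℂ)),
    0 < n ∧
    (∀ U : Submodule ℂ (Fin n → ℂ), (∀ g : G, U.map (ρ g) ≤ U) → U = ⊥ ∨ U = ⊤) ∧
    ∀ g : G, χ g = LinearMap.trace ℂ (Fin n → ℂ) (ρ g)

variable {V : Type*} [AddCommGroup V] [Module ℂ V]

/-- The fixed space `ker (w - id)` of an invertible linear map `w`. -/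
def fixedSpace (w : (V →ₗ[ℂ] V)ˣ) : Submodule ℂ V :=
  LinearMap.ker ((w : V →ₗ[ℂ] V) - LinearMap.id)

/-- `w` is a reflection: its fixed space is a hyperplane (codimension 1). -/
def IsReflection (w : (V →ₗ[ℂ] V)ˣ) : Prop :=
  Module.finrank ℂ V = Module.finrank ℂ (fixedSpace w) + 1

/-- The linear map underlying an element of `W`. -/
def toLin (W : Subgroup (V →ₗ[ℂ] V)ˣ) (w : W) : V →ₗ[ℂ] V :=
  ((w : (V →ₗ[ℂ] V)ˣ) : V →ₗ[ℂ] V)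

/-- The set of reflections of `W`. -/
def refls (W : Subgroup (V →ₗ[ℂ] V)ˣ) : Set W :=
  {t | IsReflection (t : (V →ₗ[ℂ] V)ˣ)}

/-- The arrangement of reflecting hyperplanes of `W`. -/
def arrangement (W : Subgroup (V →ₗ[ℂ] V)ˣ) : Set (Submodule ℂ V) :=
  {H | ∃ t : W, t ∈ refls W ∧ H = fixedSpace (t : (V →ₗ[ℂ] V)ˣ)}

/-- The pointwise stabilizer of a subspace `H` in `W`. -/
def ptStab (W : Subgroup (V →ₗ[ℂ] V)ˣ) (H : Submodule ℂ V) : Set W :=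
  {w | ∀ v ∈ H, toLin W w v = v}

/-- The `W`-orbit of a hyperplane `H`. -/
def orbitOf (W : Subgroup (V →ₗ[ℂ] V)ˣ) (H : Submodule ℂ V) : Set (Submodule ℂ V) :=
  {H' | ∃ w : W, H' = H.map (toLin W w)}

/-- The reflections of `W` whose hyperplane lies in the orbit of `H`. -/
def Cref (W : Subgroup (V →ₗ[ℂ] V)ˣ) (H : Submodule ℂ V) : Set W :=
  {t | t ∈ refls W ∧ fixedSpace (t : (V →ₗ[ℂ] V)ˣ) ∈ orbitOf W H}

/-- `g ∈ W` is a regular element of order `d`: it has a nonzero eigenvector,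
with eigenvalue a primitive `d`-th root of unity, lying on no reflecting hyperplane. -/
def IsRegularElt (W : Subgroup (V →ₗ[ℂ] V)ˣ) (g : W) (d : ℕ) : Prop :=
  orderOf g = d ∧ ∃ (ζ : ℂ) (v : V), v ≠ 0 ∧ IsPrimitiveRoot ζ d ∧
    toLin W g v = ζ • v ∧ ∀ H ∈ arrangement W, v ∉ H

/-- The action of `W` on `V` is irreducible. -/
def IsIrredAction (W : Subgroup (V →ₗ[ℂ] V)ˣ) : Prop :=
  ∀ U : Submodule ℂ V, (∀ w : W, U.map (toLin W w) ≤ U) → U = ⊥ ∨ U = ⊤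

/-- `f` is a length-`l` reflection factorization of `g`. -/
def IsReflFac (W : Subgroup (V →ₗ[ℂ] V)ˣ) (g : W) (l : ℕ) (f : Fin l → W) : Prop :=
  (∀ i, f i ∈ refls W) ∧ (List.ofFn f).prod = g

/-- `l` is the reflection length of `g`: the minimal length of a reflection
factorization of `g`. -/
def IsReflLength (W : Subgroup (V →ₗ[ℂ] V)ˣ) (g : W) (l : ℕ) : Prop :=
  (∃ f : Fin l → W, IsReflFac W g l f) ∧
    ∀ (k : ℕ) (f : Fin k → W), IsReflFac W g k f → l ≤ k

open Classical in
/-- `n` is the minimal number of factors whose hyperplane lies in the orbit `C`,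
over all reflection factorizations of `g` (of any length). -/
def IsMinOrbitCount (W : Subgroup (V →ₗ[ℂ] V)ˣ) (g : W)
    (C : Set (Submodule ℂ V)) (n : ℕ) : Prop :=
  (∃ (N : ℕ) (f : Fin N → W), IsReflFac W g N f ∧
      (Finset.univ.filter fun i => fixedSpace (f i : (V →ₗ[ℂ] V)ˣ) ∈ C).card = n) ∧
  ∀ (N : ℕ) (f : Fin N → W), IsReflFac W g N f →
      n ≤ (Finset.univ.filter fun i => fixedSpace (f i : (V →ₗ[ℂ] V)ˣ) ∈ C).card

namespace WFF
open MvPolynomial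
open scoped Matrix

abbrev Po (n : ℕ) := MvPolynomial (Fin n) ℂ

structure RData (n : ℕ) (G : Type*) [Group G] (h : Type*) where
  act : G →* (Po n →ₐ[ℂ] Po n)
  act_hom : ∀ g i, (act g (X i)).IsHomogeneous 1
  α : h → Po n
  α_hom : ∀ H, (α H).IsHomogeneous 1
  α_ne : ∀ H, α H ≠ 0
  α_ndvd : ∀ H H', H ≠ H' → ¬ α H ∣ α H'
  St : h → Finset G
  e : ℕ
  card_St : ∀ H, (St H).card = e
  one_St : ∀ H, 1 ∈ St H
  mul_St : ∀ H, ∀ s ∈ St H, ∀ t ∈ St H, s * t ∈ St H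
  inv_St : ∀ H, ∀ s ∈ St H, s⁻¹ ∈ St H
  act_St : ∀ H, ∀ t ∈ St H, ∀ i, α H ∣ act t (X i) - X i
  act_St_pow : ∀ H, ∀ t ∈ St H, (act t (α H)) ^ e = α H ^ e
  mv : G → h → h
  act_α : ∀ w H, ∃ c : ℂ, act w (α H) = C c * α (mv w H)
  mv_inv : ∀ w H, mv w (mv w⁻¹ H) = H
  conj_St : ∀ w H, ∀ t ∈ St H, w * t * w⁻¹ ∈ St (mv w H)

theorem hom_of_mul {n : ℕ} {a q : Po n} (ha : a.IsHomogeneous 1) (ha0 : a ≠ 0) {m : ℕ}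
    (h : (a * q).IsHomogeneous (m + 1)) : q.IsHomogeneous m := by
  have key : ∀ k, k ≠ m → homogeneousComponent k q = 0 := by
    intro k hk
    have h1 : homogeneousComponent (k+1) (a * q) = 0 := by
      rw [homogeneousComponent_of_mem h, if_neg (by omega)]
    have h2 : homogeneousComponent (k+1) (a * q) = a * homogeneousComponent k q := by
      conv_lhs => rw [← sum_homogeneousComponent q, Finset.mul_sum, map_sum]
      have : ∀ i ∈ Finset.range (q.totalDegree + 1),
          homogeneousComponent (k+1) (a * homogeneousComponent i q)
            = if i = k then a * homogeneousComponent k q else 0 := by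
        intro i _
        have h3 : (a * homogeneousComponent i q).IsHomogeneous (1 + i) :=
          ha.mul (homogeneousComponent_isHomogeneous i q)
        rw [homogeneousComponent_of_mem h3]
        by_cases hik : i = k
        · subst hik; simp [add_comm]
        · rw [if_neg hik, if_neg (by omega)]
      rw [Finset.sum_congr rfl this, Finset.sum_ite_eq']
      split_ifs with hm
      · rfl
      · rw [homogeneousComponent_eq_zero]
        · simp
        · simp at hm; omega
    rw [h2] at h1
    exact (mul_eq_zero.mp h1).resolve_left ha0
  have : q = homogeneousComponent m q := by
    conv_lhs => rw [← sum_homogeneousComponent q]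
    by_cases hm : m ∈ Finset.range (q.totalDegree + 1)
    · rw [Finset.sum_eq_single_of_mem m hm]
      intro b _ hb; exact key b hb
    · rw [homogeneousComponent_eq_zero m q (by simp at hm; omega)]
      apply Finset.sum_eq_zero
      intro b hb
      apply key b
      rintro rfl; exact hm hb
  rw [this]; exact homogeneousComponent_isHomogeneous m q

theorem hom_mul_zero {n : ℕ} {a q : Po n} (ha : a.IsHomogeneous 1) (ha0 : a ≠ 0)
    (h : (a * q).IsHomogeneous 0) : q = 0 := by
  by_contra hq
  have h1 := h.totalDegree (mul_ne_zero ha0 hq)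
  rw [totalDegree_mul_of_isDomain ha0 hq, ha.totalDegree ha0] at h1
  omega

theorem prime_lin {n : ℕ} {a : Po n} (ha : a.IsHomogeneous 1) (ha0 : a ≠ 0) : Prime a := by
  rw [← irreducible_iff_prime]
  have hd := ha.totalDegree ha0
  have hu : ∀ p : Po n, p ≠ 0 → p.totalDegree = 0 → IsUnit p := by
    intro p hp hp0
    rw [totalDegree_eq_zero_iff_eq_C] at hp0
    rw [hp0]
    apply IsUnit.map
    rw [isUnit_iff_ne_zero]
    intro h0; rw [h0] at hp0; exact hp (by simpa using hp0)
  refine ⟨?_, ?_⟩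
  · intro h
    have := (isUnit_iff_totalDegree_of_isReduced.mp h).2
    omega
  · intro p q hpq
    have hp : p ≠ 0 := by rintro rfl; simp at hpq; exact ha0 hpq
    have hq : q ≠ 0 := by rintro rfl; simp at hpq; exact ha0 hpq
    have := totalDegree_mul_of_isDomain hp hq
    rw [← hpq, hd] at this
    rcases Nat.eq_zero_or_pos p.totalDegree with h | h
    · left; exact hu p hp h
    · right; exact hu q hq (by omega)

section
variable {n : ℕ} {G : Type*} [Group G] {h : Type*} (D : RData n G h)

def cm {n r s : ℕ} (M : Matrix (Fin r) (Fin s) ℂ) : Matrix (Fin r) (Fin s) (Po n) :=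
  M.map (C : ℂ →+* Po n)

variable {r : ℕ}

theorem cm_mul {a b c : ℕ} (M : Matrix (Fin a) (Fin b) ℂ) (N : Matrix (Fin b) (Fin c) ℂ) :
    (cm (M * N) : Matrix _ _ (Po n)) = cm M * cm N := by
  exact Matrix.map_mul

theorem cm_cm {a b c : ℕ} (M : Matrix (Fin a) (Fin b) ℂ) (N : Matrix (Fin b) (Fin c) ℂ)
    (f : Fin c → Po n) : cm M *ᵥ (cm N *ᵥ f) = cm (M * N) *ᵥ f := by
  rw [cm_mul]
  exact Matrix.mulVec_mulVec _ _ _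

theorem cm_sum {a b : ℕ} {ι : Type*} (s : Finset ι) (M : ι → Matrix (Fin a) (Fin b) ℂ) :
    (cm (∑ i ∈ s, M i) : Matrix _ _ (Po n)) = ∑ i ∈ s, cm (M i) := by
  ext i j; simp [cm, Matrix.sum_apply]

theorem cm_sub {a b : ℕ} (M N : Matrix (Fin a) (Fin b) ℂ) :
    (cm (M - N) : Matrix _ _ (Po n)) = cm M - cm N := by
  ext i j; simp [cm]

theorem cm_one {a : ℕ} :
    (cm (1 : Matrix (Fin a) (Fin a) ℂ) : Matrix _ _ (Po n)) = 1 := by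
  ext i j; simp [cm, Matrix.one_apply]

theorem cm_zero {a b : ℕ} :
    (cm (0 : Matrix (Fin a) (Fin b) ℂ) : Matrix _ _ (Po n)) = 0 := by
  ext i j; simp [cm]

/-- pointwise action on vectors -/
def pact (w : G) (f : Fin r → Po n) : Fin r → Po n := fun b => D.act w (f b)

theorem pact_cm {s : ℕ} (w : G) (M : Matrix (Fin s) (Fin r) ℂ) (f : Fin r → Po n) :
    pact D w (cm M *ᵥ f) = cm M *ᵥ pact D w f := by
  ext1 a
  simp only [pact, Matrix.mulVec, dotProduct, map_sum, map_mul, cm, Matrix.map_apply]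
  apply Finset.sum_congr rfl
  intro b _
  congr 1
  exact (D.act w).commutes _

theorem pact_smul (w : G) (p : Po n) (f : Fin r → Po n) :
    pact D w (p • f) = D.act w p • pact D w f := by
  ext1 a; simp [pact]

theorem pact_mul (v w : G) (f : Fin r → Po n) :
    pact D (v * w) f = pact D v (pact D w f) := by
  ext1 a; simp [pact]

/-- the diagonal action -/
def dact (N : G →* Matrix (Fin r) (Fin r) ℂ) : Representation ℂ G (Fin r → Po n) where
  toFun w :=
    { toFun := fun f => cm (N w) *ᵥ pact D w f
      map_add' := fun f g => by
        rw [← Matrix.mulVec_add]; congr 1; ext1 a; simp [pact]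
      map_smul' := fun c f => by
        rw [RingHom.id_apply, ← Matrix.mulVec_smul]; congr 1; ext1 a; simp [pact] }
  map_one' := by
    apply LinearMap.ext
    intro f; ext1 a; simp [cm_one, pact]
  map_mul' v w := by
    apply LinearMap.ext
    intro f
    simp only [LinearMap.coe_mk, AddHom.coe_mk, Module.End.mul_apply, map_mul, pact_mul, pact_cm, cm_cm]

theorem dact_apply (N : G →* Matrix (Fin r) (Fin r) ℂ) (w : G) (f : Fin r → Po n) :
    dact D N w f = cm (N w) *ᵥ pact D w f := rfl

def U (N : G →* Matrix (Fin r) (Fin r) ℂ) (H : h) : Matrix (Fin r) (Fin r) ℂ :=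
  ∑ t ∈ D.St H, (1 - N t)

def InQ (N : G →* Matrix (Fin r) (Fin r) ℂ) (f : Fin r → Po n) : Prop :=
  ∀ H a, D.α H ^ D.e ∣ (cm (U D N H) *ᵥ f) a

theorem e_pos (H : h) : 0 < D.e := by
  rw [← D.card_St H]; exact Finset.card_pos.mpr ⟨1, D.one_St H⟩

theorem vec_dvd {p : Po n} {f : Fin r → Po n} (hf : ∀ a, p ∣ f a) : ∃ φ, f = p • φ := by
  choose φ hφ using hf
  exact ⟨φ, by ext1 a; simp [hφ a]⟩

variable (N : G →* Matrix (Fin r) (Fin r) ℂ)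

theorem N_mul_sum (H : h) (t : G) (ht : t ∈ D.St H) :
    N t * ∑ s ∈ D.St H, N s = ∑ s ∈ D.St H, N s := by
  rw [Finset.mul_sum]
  refine Finset.sum_bij' (fun s _ => t * s) (fun s _ => t⁻¹ * s) ?_ ?_ ?_ ?_ ?_
  · intro s hs; exact D.mul_St H _ ht _ hs
  · intro s hs; exact D.mul_St H _ (D.inv_St H _ ht) _ hs
  · intro s _; simp
  · intro s _; simp
  · intro s _; simp

theorem sum_mul_N (H : h) (t : G) (ht : t ∈ D.St H) :
    (∑ s ∈ D.St H, N s) * N t = ∑ s ∈ D.St H, N s := by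
  rw [Finset.sum_mul]
  refine Finset.sum_bij' (fun s _ => s * t) (fun s _ => s * t⁻¹) ?_ ?_ ?_ ?_ ?_
  · intro s hs; exact D.mul_St H _ hs _ ht
  · intro s hs; exact D.mul_St H _ hs _ (D.inv_St H _ ht)
  · intro s _; simp
  · intro s _; simp
  · intro s _; simp

theorem U_eq (H : h) : U D N H = (D.e : ℂ) • 1 - ∑ s ∈ D.St H, N s := by
  rw [U, Finset.sum_sub_distrib, Finset.sum_const, D.card_St, ← Nat.cast_smul_eq_nsmul ℂ]

theorem U_comm (H : h) (t : G) (ht : t ∈ D.St H) : U D N H * N t = N t * U D N H := by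
  rw [U_eq, sub_mul, mul_sub, N_mul_sum D N H t ht, sum_mul_N D N H t ht]; simp

theorem sum_mul_U (H : h) : (∑ s ∈ D.St H, N s) * U D N H = 0 := by
  rw [U, Finset.mul_sum]
  apply Finset.sum_eq_zero
  intro t ht
  rw [mul_sub, mul_one, sum_mul_N D N H t ht, sub_self]

theorem U_conj (w : G) (H : h) : U D N H * N w = N w * U D N (D.mv w⁻¹ H) := by
  rw [U, U, Finset.sum_mul, Finset.mul_sum]
  refine Finset.sum_bij' (fun s _ => w⁻¹ * s * w) (fun s _ => w * s * w⁻¹) ?_ ?_ ?_ ?_ ?_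
  · intro s hs
    have := D.conj_St w⁻¹ H s hs
    simpa using this
  · intro s hs
    have := D.conj_St w _ s hs
    rwa [D.mv_inv] at this
  · intro s _; group
  · intro s _; group
  · intro s _
    rw [sub_mul, mul_sub, ← map_mul, ← map_mul]
    simp [mul_assoc]

theorem act_congr (H : h) (t : G) (ht : t ∈ D.St H) (p : Po n) : D.α H ∣ D.act t p - p := by
  rw [← Ideal.mem_span_singleton, ← Ideal.Quotient.mk_eq_mk_iff_sub_mem]
  have : ((Ideal.Quotient.mkₐ ℂ (Ideal.span {D.α H})).comp (D.act t))
      = Ideal.Quotient.mkₐ ℂ (Ideal.span {D.α H}) := by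
    apply MvPolynomial.algHom_ext
    intro i
    simp only [AlgHom.comp_apply, Ideal.Quotient.mkₐ_eq_mk]
    rw [Ideal.Quotient.mk_eq_mk_iff_sub_mem, Ideal.mem_span_singleton]
    exact D.act_St H t ht i
  exact congrArg (fun F => F p) this

theorem cm_dvd {s : ℕ} {p : Po n} (M : Matrix (Fin s) (Fin r) ℂ) {f : Fin r → Po n}
    (hf : ∀ a, p ∣ f a) (a) : p ∣ (cm M *ᵥ f) a := by
  obtain ⟨φ, rfl⟩ := vec_dvd hf
  rw [Matrix.mulVec_smul]; exact ⟨_, rfl⟩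

theorem dact_congr (H : h) (t : G) (ht : t ∈ D.St H) (f : Fin r → Po n) (a) :
    D.α H ∣ (dact D N t f - cm (N t) *ᵥ f) a := by
  rw [dact_apply, ← Matrix.mulVec_sub]
  apply cm_dvd
  intro b; exact act_congr D H t ht _

theorem inQ_dact {f : Fin r → Po n} (hf : InQ D N f) (w : G) : InQ D N (dact D N w f) := by
  intro H a
  obtain ⟨φ, hφ⟩ := vec_dvd (hf (D.mv w⁻¹ H))
  rw [dact_apply, cm_cm, U_conj, ← cm_cm,
    ← pact_cm, hφ, pact_smul, Matrix.mulVec_smul, map_pow]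
  obtain ⟨c, hc⟩ := D.act_α w (D.mv w⁻¹ H)
  rw [hc, D.mv_inv, mul_pow]
  simp only [Pi.smul_apply, smul_eq_mul]
  exact Dvd.dvd.mul_right (Dvd.intro_left _ rfl) _

/-- `Σ_{t ∈ W_H} (f - t f)` -/
def S (H : h) (f : Fin r → Po n) : Fin r → Po n := ∑ t ∈ D.St H, (f - dact D N t f)

theorem sum_dact_congr (H : h) (f : Fin r → Po n) (a) :
    D.α H ∣ (∑ t ∈ D.St H, dact D N t f - cm (∑ t ∈ D.St H, N t) *ᵥ f) a := by
  rw [cm_sum, Matrix.sum_mulVec, ← Finset.sum_sub_distrib, Finset.sum_apply]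
  exact Finset.dvd_sum fun t ht => dact_congr D N H t ht f a

theorem S_dvd {f : Fin r → Po n} (hf : InQ D N f) (H : h) (a) : D.α H ∣ S D N H f a := by
  have h1 : D.α H ∣ (cm (U D N H) *ᵥ f) a := (dvd_pow_self _ (e_pos D H).ne').trans (hf H a)
  have h2 : (S D N H f - cm (U D N H) *ᵥ f) = - (∑ t ∈ D.St H, (dact D N t f - cm (N t) *ᵥ f)) := by
    rw [S, U, cm_sum, Matrix.sum_mulVec, ← Finset.sum_sub_distrib, ← Finset.sum_neg_distrib]
    apply Finset.sum_congr rfl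
    intro t _
    rw [cm_sub, cm_one, Matrix.sub_mulVec, Matrix.one_mulVec]; abel
  have h3 : D.α H ∣ (S D N H f - cm (U D N H) *ᵥ f) a := by
    rw [h2, Pi.neg_apply, dvd_neg, Finset.sum_apply]
    exact Finset.dvd_sum fun t ht => dact_congr D N H t ht f a
  have := dvd_add h3 h1
  simpa using this

def pd (i : Fin n) (f : Fin r → Po n) : Fin r → Po n := fun a => pderiv i (f a)

theorem pd_cm {s : ℕ} (i : Fin n) (M : Matrix (Fin s) (Fin r) ℂ) (f : Fin r → Po n) :
    cm M *ᵥ pd i f = pd i (cm M *ᵥ f) := by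
  ext1 a
  simp [pd, Matrix.mulVec, dotProduct, cm, map_sum]

variable [Fintype h] [DecidableEq h]

theorem dunkl_inQ {f : Fin r → Po n} (hf : InQ D N f) (q : h → Fin r → Po n)
    (hq : ∀ H, S D N H f = D.α H • q H) (i : Fin n) :
    InQ D N (pd i f - ∑ H, pderiv i (D.α H) • q H) := by
  intro H0 a
  set α := D.α H0 with hα
  have hprime : Prime α := prime_lin (D.α_hom H0) (D.α_ne H0)
  have hoth : ∀ H, H ≠ H0 → ∀ a, α ^ D.e ∣ (cm (U D N H0) *ᵥ q H) a := by
    intro H hH a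
    apply hprime.pow_dvd_of_dvd_mul_left (a := D.α H) D.e (D.α_ndvd H0 H hH.symm)
    have : D.α H * (cm (U D N H0) *ᵥ q H) a = (cm (U D N H0) *ᵥ S D N H f) a := by
      rw [hq, Matrix.mulVec_smul]; simp
    rw [this, S, Matrix.mulVec_sum, Finset.sum_apply]
    refine Finset.dvd_sum fun t _ => ?_
    rw [Matrix.mulVec_sub]
    exact dvd_sub (hf H0 a) (inQ_dact D N hf t H0 a)
  have hself : α ^ D.e ∣ (pd i (cm (U D N H0) *ᵥ f)
      - pderiv i α • (cm (U D N H0) *ᵥ q H0)) a := by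
    obtain ⟨φ, hφ⟩ := vec_dvd (hf H0)
    rw [← hα] at hφ
    have hα0 : α ^ D.e ≠ 0 := pow_ne_zero _ (D.α_ne H0)
    have hE : cm (∑ t ∈ D.St H0, N t) *ᵥ φ = 0 := by
      have : α ^ D.e • (cm (∑ t ∈ D.St H0, N t) *ᵥ φ) = 0 := by
        rw [← Matrix.mulVec_smul, ← hφ, cm_cm, sum_mul_U, cm_zero,
          Matrix.zero_mulVec]
      exact (smul_eq_zero.mp this).resolve_left hα0
    have hUt : ∀ t ∈ D.St H0, cm (U D N H0) *ᵥ dact D N t f = α ^ D.e • dact D N t φ := by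
      intro t ht
      rw [dact_apply, cm_cm, U_comm D N H0 t ht, ← cm_cm, ← pact_cm, hφ, pact_smul, Matrix.mulVec_smul, map_pow,
        D.act_St_pow H0 t ht, dact_apply]
    have hUq : α • (cm (U D N H0) *ᵥ q H0)
        = α ^ D.e • ((D.e : Po n) • φ - ∑ t ∈ D.St H0, dact D N t φ) := by
      rw [← Matrix.mulVec_smul, ← hq, S, Matrix.mulVec_sum]
      have : ∀ t ∈ D.St H0, cm (U D N H0) *ᵥ (f - dact D N t f)
          = α ^ D.e • (φ - dact D N t φ) := by
        intro t ht
        rw [Matrix.mulVec_sub, hUt t ht, hφ, smul_sub]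
      rw [Finset.sum_congr rfl this, ← Finset.smul_sum, Finset.sum_sub_distrib, Finset.sum_const,
        D.card_St, Nat.cast_smul_eq_nsmul]
    have hd := sum_dact_congr D N H0 φ a
    rw [hE, sub_zero] at hd
    have key : α * (pd i (cm (U D N H0) *ᵥ f) - pderiv i α • (cm (U D N H0) *ᵥ q H0)) a
        = α ^ D.e * (α * pderiv i (φ a) + pderiv i α * (∑ t ∈ D.St H0, dact D N t φ) a) := by
      have h1 := congrFun hUq a
      simp only [Pi.smul_apply, Pi.sub_apply, smul_eq_mul] at h1
      rw [hφ]
      simp only [Pi.sub_apply, pd, Pi.smul_apply, smul_eq_mul, pderiv_mul, pderiv_pow]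
      have hee : α * α ^ (D.e - 1) = α ^ D.e := by
        rw [← pow_succ']; congr 1; have := e_pos D H0; omega
      linear_combination (-(pderiv i α)) * h1 + (D.e * pderiv i α * φ a) * hee
    obtain ⟨x, hx⟩ := hd
    rw [hx] at key
    refine ⟨pderiv i (φ a) + pderiv i α * x, ?_⟩
    apply mul_left_cancel₀ (D.α_ne H0)
    rw [← hα, key]; ring
  have hsplit : cm (U D N H0) *ᵥ (pd i f - ∑ H, pderiv i (D.α H) • q H)
      = (pd i (cm (U D N H0) *ᵥ f) - pderiv i α • (cm (U D N H0) *ᵥ q H0))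
        - ∑ H ∈ Finset.univ.erase H0, pderiv i (D.α H) • (cm (U D N H0) *ᵥ q H) := by
    rw [Matrix.mulVec_sub, pd_cm, Matrix.mulVec_sum, ← Finset.add_sum_erase _ _ (Finset.mem_univ H0)]
    simp only [Matrix.mulVec_smul]
    rw [sub_sub]
  rw [hsplit, Pi.sub_apply, Finset.sum_apply]
  apply dvd_sub hself
  refine Finset.dvd_sum fun H hH => ?_
  simp only [Pi.smul_apply, smul_eq_mul]
  exact (hoth H (Finset.ne_of_mem_erase hH) a).mul_left _

end
end WFF

namespace WFF
open MvPolynomial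
open scoped Matrix

section
variable {n : ℕ} {G : Type*} [Group G] {h : Type*} (D : RData n G h) {r : ℕ}
  (N : G →* Matrix (Fin r) (Fin r) ℂ)

def Hm {n r : ℕ} (m : ℕ) (f : Fin r → Po n) : Prop := ∀ a, (f a).IsHomogeneous m

theorem act_hm (w : G) {p : Po n} {m : ℕ} (hp : p.IsHomogeneous m) :
    (D.act w p).IsHomogeneous m := by
  have h1 : D.act w = aeval (fun i => D.act w (X i)) := by
    apply MvPolynomial.algHom_ext; intro i; simp
  rw [h1]
  have := hp.aeval (fun i => D.act w (X i)) (fun i => D.act_hom w i)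
  simpa using this

theorem dact_hm (w : G) {f : Fin r → Po n} {m : ℕ} (hf : Hm m f) : Hm m (dact D N w f) := by
  intro a
  simp only [dact_apply, Matrix.mulVec, dotProduct, cm, Matrix.map_apply, pact]
  apply IsHomogeneous.sum
  intro b _
  exact (act_hm D w (hf b)).C_mul _

theorem InQ.add {f g : Fin r → Po n} (hf : InQ D N f) (hg : InQ D N g) : InQ D N (f + g) := by
  intro H a
  rw [Matrix.mulVec_add]
  exact dvd_add (hf H a) (hg H a)

theorem InQ.smul {f : Fin r → Po n} (hf : InQ D N f) (p : Po n) : InQ D N (p • f) := by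
  intro H a
  rw [Matrix.mulVec_smul]
  exact (hf H a).mul_left p

theorem InQ.csmul {f : Fin r → Po n} (hf : InQ D N f) (c : ℂ) : InQ D N (c • f) := by
  have : c • f = (C c : Po n) • f := by
    ext1 a; simp [MvPolynomial.smul_eq_C_mul]
  rw [this]; exact hf.smul D N _

/-- homogeneous quasi-invariants of degree m -/
def KK (m : ℕ) : Submodule ℂ (Fin r → Po n) where
  carrier := {f | InQ D N f ∧ Hm m f}
  zero_mem' := ⟨fun H a => by simp, fun a => isHomogeneous_zero _ _ _⟩
  add_mem' := fun {f g} hf hg => ⟨hf.1.add D N hg.1, fun a => (hf.2 a).add (hg.2 a)⟩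
  smul_mem' := fun c f hf => ⟨hf.1.csmul D N c, fun a => by
    have : (c • f) a = C c * f a := by simp [MvPolynomial.smul_eq_C_mul]
    rw [this]; exact (hf.2 a).C_mul c⟩

theorem KK_stable (m : ℕ) (x : MonoidAlgebra ℂ G) {f : Fin r → Po n} (hf : f ∈ KK D N m) :
    (dact D N).asAlgebraHom x f ∈ KK D N m := by
  induction x using MonoidAlgebra.induction_on with
  | of w => 
    rw [Representation.asAlgebraHom_of]
    exact ⟨inQ_dact D N hf.1 w, dact_hm D N w hf.2⟩
  | add x y hx hy => 
    rw [map_add]; exact (KK D N m).add_mem hx hy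
  | smul c x hx => rw [map_smul]; exact (KK D N m).smul_mem c hx

theorem S_hm (H : h) {f : Fin r → Po n} {m : ℕ} (hf : Hm m f) : Hm m (S D N H f) := by
  intro a
  rw [S, Finset.sum_apply]
  apply IsHomogeneous.sum
  intro t _
  exact (hf a).sub (dact_hm D N t hf a)

variable [Fintype h] [DecidableEq h]

theorem exists_KK (hr : 0 < r) : ∃ m, ∃ f ∈ KK D N m, f ≠ 0 := by
  refine ⟨∑ H : h, 1 * D.e, fun _ => ∏ H, D.α H ^ D.e, ⟨?_, ?_⟩, ?_⟩
  · intro H a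
    apply cm_dvd
    intro b
    exact Finset.dvd_prod_of_mem (fun H => D.α H ^ D.e) (Finset.mem_univ H)
  · intro a
    apply IsHomogeneous.prod
    intro H _
    exact (D.α_hom H).pow _
  · intro h0
    have := congrFun h0 ⟨0, hr⟩
    simp only [Pi.zero_apply] at this
    exact Finset.prod_ne_zero_iff.mpr (fun H _ => pow_ne_zero _ (D.α_ne H)) this

theorem flat_of_min {m : ℕ} (hmin : ∀ m' < m, ∀ f ∈ KK D N m', f = 0) {f : Fin r → Po n}
    (hf : f ∈ KK D N m) (q : h → Fin r → Po n)
    (hq : ∀ H, S D N H f = D.α H • q H) (i : Fin n) :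
    pd i f = ∑ H, pderiv i (D.α H) • q H := by
  have hS : ∀ H a, (D.α H * q H a).IsHomogeneous m := by
    intro H a
    have := S_hm D N H hf.2 a
    rw [hq] at this
    simpa using this
  rcases Nat.eq_zero_or_pos m with rfl | hm
  · have hq0 : ∀ H, q H = 0 := by
      intro H; ext1 a; exact hom_mul_zero (D.α_hom H) (D.α_ne H) (hS H a)
    have : ∀ a, pderiv i (f a) = 0 := by
      intro a
      have h1 := (hf.2 a)
      rw [← totalDegree_zero_iff_isHomogeneous, totalDegree_eq_zero_iff_eq_C] at h1
      rw [h1]; simp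
    ext1 a
    simp [pd, this, hq0]
  · obtain ⟨m, rfl⟩ : ∃ k, m = k + 1 := ⟨m - 1, by omega⟩
    rw [← sub_eq_zero]
    apply hmin m (by omega)
    refine ⟨dunkl_inQ D N hf.1 q hq i, ?_⟩
    intro a
    rw [Pi.sub_apply, Finset.sum_apply]
    apply IsHomogeneous.sub
    · have := (hf.2 a).pderiv (i := i)
      simpa [pd] using this
    · apply IsHomogeneous.sum
      intro H _
      have h1 : (pderiv i (D.α H)).IsHomogeneous 0 := by
        simpa using (D.α_hom H).pderiv (i := i)
      have h2 := h1.mul (hom_of_mul (D.α_hom H) (D.α_ne H) (hS H a))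
      simpa using h2

variable {ι : Type*} [Fintype ι] [DecidableEq ι] {d : ι → ℕ}
  (π : MonoidAlgebra ℂ G ≃ₐ[ℂ] ∀ i, Matrix (Fin (d i)) (Fin (d i)) ℂ)

def rp (i : ι) : G →* Matrix (Fin (d i)) (Fin (d i)) ℂ where
  toFun w := π (MonoidAlgebra.of ℂ G w) i
  map_one' := by rw [map_one, map_one]; rfl
  map_mul' v w := by rw [map_mul, map_mul]; rfl

def Bm (χ : G →* Matrix (Fin r) (Fin r) ℂ) (j : Fin n) (c b : Fin r) : Po n :=
  ∑ H, pderiv j (D.α H) * (∏ H' ∈ Finset.univ.erase H, D.α H') * C (U D χ H c b)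

/-- A flat equivariant morphism. -/
structure Flat {s : ℕ} (χ : G →* Matrix (Fin s) (Fin s) ℂ) (m : ℕ)
    (F : Fin s → Fin r → Po n) : Prop where
  ne : ∃ b, F b ≠ 0
  inQ : ∀ b, InQ D N (F b)
  hm : ∀ b, Hm m (F b)
  equiv : ∀ w b, dact D N w (F b) = ∑ c, χ w c b • F c
  flat : ∀ j b, (∏ H, D.α H) • pd j (F b) = ∑ c, Bm D χ j c b • F c
  euler : ∀ b, (m : ℂ) • F b = ∑ c, (∑ H, U D χ H) c b • F c

def Eu (i : ι) (a b : Fin (d i)) : MonoidAlgebra ℂ G :=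
  π.symm (Pi.single i (Matrix.single a b 1))

theorem Eu_one : (1 : MonoidAlgebra ℂ G) = ∑ i, ∑ a, Eu π i a a := by
  apply π.injective
  simp only [map_sum, Eu, AlgEquiv.apply_symm_apply, map_one]
  ext j a b
  simp only [Finset.sum_apply, Matrix.sum_apply, Pi.one_apply]
  rw [Finset.sum_eq_single_of_mem j (Finset.mem_univ _)]
  · rw [Finset.sum_eq_single_of_mem a (Finset.mem_univ _)]
    · simp [Matrix.single_apply, Matrix.one_apply]
    · intro c _ hc
      simp [Matrix.single_apply, hc]
  · intro i _ hij
    apply Finset.sum_eq_zero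
    intro c _
    rw [Pi.single_eq_of_ne hij.symm]; rfl

theorem of_mul_Eu (i : ι) (w : G) (a b : Fin (d i)) :
    MonoidAlgebra.of ℂ G w * Eu π i b a = ∑ c, rp π i w c b • Eu π i c a := by
  apply π.injective
  simp only [map_mul, map_sum, map_smul, Eu, AlgEquiv.apply_symm_apply]
  ext j x y
  simp only [Pi.mul_apply, Finset.sum_apply, Pi.smul_apply, Matrix.sum_apply, Matrix.smul_apply]
  by_cases hj : j = i
  · subst hj
    simp only [Pi.single_eq_same, rp, MonoidHom.coe_mk, OneHom.coe_mk, Matrix.mul_apply,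
      Matrix.single_apply, smul_eq_mul]
    by_cases hy : a = y <;> simp [hy]
  · simp [Pi.single_eq_of_ne hj]

theorem S_F {s : ℕ} (χ : G →* Matrix (Fin s) (Fin s) ℂ) {F : Fin s → Fin r → Po n}
    (heq : ∀ w b, dact D N w (F b) = ∑ c, χ w c b • F c) (H : h) (b : Fin s) :
    S D N H (F b) = ∑ c, (U D χ H c b) • F c := by
  simp only [S, U, Matrix.sum_apply, Finset.sum_smul]
  rw [Finset.sum_comm]
  apply Finset.sum_congr rfl
  intro t _
  simp only [heq, Matrix.sub_apply, sub_smul, Finset.sum_sub_distrib]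
  congr 1
  simp [Matrix.one_apply]

theorem flat_aux1 {s : ℕ} (χ : G →* Matrix (Fin s) (Fin s) ℂ) {F : Fin s → Fin r → Po n}
    (heq : ∀ w b, dact D N w (F b) = ∑ c, χ w c b • F c)
    (q : Fin s → h → Fin r → Po n)
    (hq : ∀ b H, S D N H (F b) = D.α H • q b H)
    (hfl : ∀ j b, pd j (F b) = ∑ H, pderiv j (D.α H) • q b H) (j : Fin n) (b : Fin s) :
    (∏ H, D.α H) • pd j (F b) = ∑ c, Bm D χ j c b • F c := by
  rw [hfl, Finset.smul_sum]
  simp only [Bm, Finset.sum_smul]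
  rw [Finset.sum_comm]
  apply Finset.sum_congr rfl
  intro H _
  have hqH := hq b H
  rw [S_F D N χ heq] at hqH
  ext1 x
  have h1 := congrFun hqH x
  simp only [Finset.sum_apply, Pi.smul_apply, smul_eq_mul, MvPolynomial.smul_eq_C_mul] at h1 ⊢
  have h2 : ∀ c, pderiv j (D.α H) * (∏ H' ∈ Finset.univ.erase H, D.α H') * C (U D χ H c b) * F c x
      = (pderiv j (D.α H) * (∏ H' ∈ Finset.univ.erase H, D.α H')) * (C (U D χ H c b) * F c x) :=
    fun c => mul_assoc _ _ _
  simp only [h2]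
  rw [← Finset.mul_sum, h1, ← Finset.mul_prod_erase _ _ (Finset.mem_univ H)]
  ring

theorem flat_aux2 {s m : ℕ} (χ : G →* Matrix (Fin s) (Fin s) ℂ) {F : Fin s → Fin r → Po n}
    (heq : ∀ w b, dact D N w (F b) = ∑ c, χ w c b • F c)
    (hF : ∀ b, Hm m (F b))
    (q : Fin s → h → Fin r → Po n)
    (hq : ∀ b H, S D N H (F b) = D.α H • q b H)
    (hfl : ∀ j b, pd j (F b) = ∑ H, pderiv j (D.α H) • q b H) (b : Fin s) :
    (m : ℂ) • F b = ∑ c, (∑ H, U D χ H) c b • F c := by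
  have h2 : ∑ j, (X j : Po n) • pd j (F b) = ∑ H, S D N H (F b) := by
    simp only [hfl, Finset.smul_sum, hq]
    rw [Finset.sum_comm]
    apply Finset.sum_congr rfl
    intro H _
    simp only [smul_smul]
    rw [← Finset.sum_smul]
    congr 1
    have := (D.α_hom H).sum_X_mul_pderiv
    simpa using this
  have h3 : ∑ j, (X j : Po n) • pd j (F b) = (m : ℂ) • F b := by
    ext1 x
    have := (hF b x).sum_X_mul_pderiv
    simp only [Finset.sum_apply, Pi.smul_apply, smul_eq_mul, pd]
    rw [this, Nat.cast_smul_eq_nsmul]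
  rw [← h3, h2]
  simp only [S_F D N χ heq, Matrix.sum_apply, Finset.sum_smul]
  rw [Finset.sum_comm]

theorem exists_flat (hr : 0 < r) : ∃ i m F, Flat D N (rp π i) m F := by
  classical
  have hex := exists_KK D N hr
  let m := Nat.find hex
  obtain ⟨k, hk, hk0⟩ := Nat.find_spec hex
  have hmin : ∀ m' < m, ∀ f ∈ KK D N m', f = 0 := by
    intro m' hm' f hf
    by_contra h0
    exact Nat.find_min hex hm' ⟨f, hf, h0⟩
  obtain ⟨i, a, ha⟩ : ∃ i a, (dact D N).asAlgebraHom (Eu π i a a) k ≠ 0 := by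
    by_contra hcon
    push Not at hcon
    apply hk0
    have : k = (dact D N).asAlgebraHom 1 k := by simp
    rw [this, Eu_one π]
    simp only [map_sum, LinearMap.sum_apply, hcon, Finset.sum_const_zero]
  let F : Fin (d i) → Fin r → Po n := fun b => (dact D N).asAlgebraHom (Eu π i b a) k
  have hF : ∀ b, F b ∈ KK D N m := fun b => KK_stable D N m _ hk
  have heq : ∀ w b, dact D N w (F b) = ∑ c, rp π i w c b • F c := by
    intro w b
    calc dact D N w (F b) = (dact D N).asAlgebraHom (MonoidAlgebra.of ℂ G w * Eu π i b a) k := by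
          rw [map_mul, Representation.asAlgebraHom_of]; rfl
      _ = _ := by
          rw [of_mul_Eu]
          simp only [map_sum, map_smul, LinearMap.sum_apply, LinearMap.smul_apply, F]
  have hq : ∀ b H, ∃ q, S D N H (F b) = D.α H • q := fun b H => vec_dvd (S_dvd D N (hF b).1 H)
  choose q hq using hq
  have hfl : ∀ j b, pd j (F b) = ∑ H, pderiv j (D.α H) • q b H := fun j b =>
    flat_of_min D N hmin (hF b) (q b) (hq b) j
  exact ⟨i, m, F, ⟨a, ha⟩, fun b => (hF b).1, fun b => (hF b).2, heq,
    flat_aux1 D N _ heq q hq hfl, flat_aux2 D N _ heq (fun b => (hF b).2) q hq hfl⟩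

end
end WFF

namespace WFF
open MvPolynomial
open scoped Matrix

/-- restriction to a line -/
def lineMap {n : ℕ} (x0 v : Fin n → ℂ) : Po n →ₐ[ℂ] Polynomial ℂ :=
  aeval (fun i => Polynomial.C (x0 i) + Polynomial.X * Polynomial.C (v i))

theorem lineMap_C {n : ℕ} (x0 v : Fin n → ℂ) (a : ℂ) : lineMap x0 v (C a) = Polynomial.C a := by
  rw [lineMap, ← MvPolynomial.algebraMap_eq, AlgHom.commutes]; rfl

theorem eval_lineMap {n : ℕ} (x0 v : Fin n → ℂ) (p : Po n) (s : ℂ) :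
    (lineMap x0 v p).eval s = eval (fun i => x0 i + s * v i) p := by
  induction p using MvPolynomial.induction_on with
  | C a => rw [lineMap_C]; simp
  | add p q hp hq => simp [hp, hq]
  | mul_X p i hp => rw [map_mul, Polynomial.eval_mul, hp]; simp [lineMap, mul_comm (v i) s]

theorem derivative_lineMap {n : ℕ} (x0 v : Fin n → ℂ) (p : Po n) :
    Polynomial.derivative (lineMap x0 v p)
      = ∑ j, Polynomial.C (v j) * lineMap x0 v (pderiv j p) := by
  induction p using MvPolynomial.induction_on with
  | C a => rw [lineMap_C]; simp
  | add p q hp hq => simp [hp, hq, mul_add, Finset.sum_add_distrib]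
  | mul_X p i hp =>
    rw [map_mul, Polynomial.derivative_mul, hp]
    have h1 : ∀ j, Polynomial.C (v j) * lineMap x0 v (pderiv j (p * X i))
        = (Polynomial.C (v j) * lineMap x0 v (pderiv j p)) * lineMap x0 v (X i)
          + (if j = i then Polynomial.C (v j) * lineMap x0 v p else 0) := by
      intro j
      rw [pderiv_mul, map_add, map_mul, map_mul, pderiv_X]
      by_cases hj : j = i
      · subst hj; simp; ring
      · have hj' : i ≠ j := fun h => hj h.symm
        simp [hj, hj', Pi.single_apply]; ring
    simp only [h1, Finset.sum_add_distrib, Finset.sum_mul, Finset.sum_ite_eq', Finset.mem_univ, if_true]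
    congr 1
    simp [lineMap]; ring

theorem flat_vanish {n s : ℕ} (δ : Po n) (B : Fin n → Fin s → Fin s → Po n) (G : Fin s → Po n)
    (hG : ∀ j b, δ * pderiv j (G b) = ∑ c, B j c b * G c) (x0 : Fin n → ℂ)
    (hx0 : ∀ b, eval x0 (G b) = 0) (hδ : eval x0 δ ≠ 0) (b : Fin s) : G b = 0 := by
  apply MvPolynomial.funext
  intro y
  rw [map_zero]
  set v : Fin n → ℂ := fun i => y i - x0 i with hv
  have hXδ : ¬ Polynomial.X ∣ lineMap x0 v δ := by
    rw [Polynomial.X_dvd_iff, Polynomial.coeff_zero_eq_eval_zero, eval_lineMap]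
    simpa using hδ
  have key : ∀ k b, Polynomial.X ^ (k+1) ∣ lineMap x0 v (G b) := by
    intro k
    induction k with
    | zero =>
      intro b
      rw [zero_add, pow_one, Polynomial.X_dvd_iff, Polynomial.coeff_zero_eq_eval_zero, eval_lineMap]
      simpa using hx0 b
    | succ k ih =>
      intro b
      have h1 : Polynomial.X ^ (k+1) ∣ lineMap x0 v δ * Polynomial.derivative (lineMap x0 v (G b)) := by
        rw [derivative_lineMap, Finset.mul_sum]
        apply Finset.dvd_sum
        intro j _
        have : lineMap x0 v δ * (Polynomial.C (v j) * lineMap x0 v (pderiv j (G b)))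
            = Polynomial.C (v j) * lineMap x0 v (∑ c, B j c b * G c) := by
          rw [← hG, map_mul]; ring
        rw [this, map_sum]
        apply Dvd.dvd.mul_left
        apply Finset.dvd_sum
        intro c _
        rw [map_mul]
        exact (ih c).mul_left _
      have h2 := Polynomial.prime_X.pow_dvd_of_dvd_mul_left (k+1) hXδ h1
      obtain ⟨q, hq⟩ := ih b
      rw [hq, Polynomial.derivative_mul, Polynomial.derivative_X_pow] at h2
      have h3 := (Nat.dvd_refl 0)
      have h4 : (Polynomial.X : Polynomial ℂ) ^ (k+1) ∣
          Polynomial.X ^ k * (Polynomial.C ((k+1 : ℕ) : ℂ) * q) := by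
        have := dvd_sub h2 (Dvd.intro (Polynomial.derivative q) rfl :
          (Polynomial.X : Polynomial ℂ) ^ (k+1) ∣ Polynomial.X ^ (k+1) * Polynomial.derivative q)
        rw [add_sub_cancel_right] at this
        simp only [Nat.add_sub_cancel] at this
        convert this using 1
        ring
      rw [pow_succ, mul_dvd_mul_iff_left (pow_ne_zero _ Polynomial.X_ne_zero)] at h4
      have h5 : Polynomial.X ∣ q := by
        rcases Polynomial.prime_X.dvd_or_dvd h4 with h | h
        · exfalso
          rw [Polynomial.X_dvd_iff, Polynomial.coeff_C_zero] at h
          exact Nat.cast_ne_zero.mpr (Nat.succ_ne_zero k) h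
        · exact h
      rw [hq, pow_succ (n := k+1)]
      exact mul_dvd_mul_left _ h5
  have h0 : lineMap x0 v (G b) = 0 := by
    by_contra hne
    have := Polynomial.natDegree_le_of_dvd (key (lineMap x0 v (G b)).natDegree b) hne
    simp at this
  have := eval_lineMap x0 v (G b) 1
  rw [h0] at this
  simp only [Polynomial.eval_zero] at this
  rw [this]
  congr 2
  ext i; simp [hv]

theorem idem_det {r : ℕ} (Q : Matrix (Fin r) (Fin r) ℂ) (hQ : Q * Q = Q) :
    ∃ k ≤ r, Q.trace = k ∧ ∀ (n : ℕ) (p : Po n), (1 + p • (cm Q : Matrix _ _ (Po n))).det = (1 + p) ^ k := by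
  classical
  let Y : Polynomial ℂ := Polynomial.X
  let A : Matrix (Fin r) (Fin r) (Polynomial ℂ) := Q.map Polynomial.C
  have hA : A * A = A := by
    have : (Q * Q).map Polynomial.C = A * A := Matrix.map_mul
    rw [← this, hQ]
  have h1 : (1 + Y • A) * (1 + Y • (1 - A)) = (1 + Y) • 1 := by
    rw [mul_add, add_mul, mul_one, add_mul]
    simp only [smul_sub, mul_sub, Matrix.mul_smul, Matrix.smul_mul, one_mul, mul_one, hA, sub_self, add_smul, one_smul]
    abel
  have h2 : (1 + Y • A).det ∣ (1 + Y) ^ r := by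
    refine ⟨(1 + Y • (1 - A)).det, ?_⟩
    rw [← Matrix.det_mul, h1, Matrix.det_smul]; simp
  have hp : Prime (1 + Y) := by
    have : (1 + Y) = Polynomial.X - Polynomial.C (-1) := by simp [Y]; ring
    rw [this]; exact Polynomial.prime_X_sub_C _
  obtain ⟨k, hk, hass⟩ := (dvd_prime_pow hp r).1 h2
  obtain ⟨u, hu⟩ := hass
  obtain ⟨c, hc, hcu⟩ := Polynomial.isUnit_iff.mp u.isUnit
  have e0 : (1 + Y • A).det.eval 0 = 1 := by
    rw [← Polynomial.coe_evalRingHom, RingHom.map_det]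
    have : (Polynomial.evalRingHom (0:ℂ)).mapMatrix (1 + Y • A) = 1 := by
      ext i j
      simp [Y, Matrix.one_apply]
      split_ifs <;> simp
    rw [this, Matrix.det_one]
  have hdet : (1 + Y • A).det = (1 + Y) ^ k := by
    have := congrArg (Polynomial.eval 0) hu
    rw [← hcu] at this
    simp [e0, Y] at this
    rw [← hu, ← hcu, this]; simp
  refine ⟨k, hk, ?_, ?_⟩
  · have := Matrix.derivative_det_one_add_X_smul Q
    rw [← this]
    change (Polynomial.derivative (1 + Y • A).det).eval 0 = _
    rw [hdet]
    simp [Polynomial.derivative_pow, Y]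
  · intro n p
    have := congrArg (Polynomial.aeval p) hdet
    rw [AlgHom.map_det] at this
    convert this using 2
    · ext1 i j
      simp [Y, A, cm, Matrix.one_apply]
      exact mul_comm _ _
    · simp [Y]

end WFF

namespace WFF
open MvPolynomial
open scoped Matrix

section
variable {n : ℕ} {G : Type*} [Group G] {h : Type*} (D : RData n G h)
  [Fintype h] [DecidableEq h]
  {ι : Type*} [Fintype ι] [DecidableEq ι] {d : ι → ℕ}
  (π : MonoidAlgebra ℂ G ≃ₐ[ℂ] ∀ i, Matrix (Fin (d i)) (Fin (d i)) ℂ)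

theorem act_inv_act (w : G) (p : Po n) : D.act w⁻¹ (D.act w p) = p := by
  rw [← AlgHom.mul_apply, ← map_mul]; simp

theorem act_C (w : G) (a : ℂ) : D.act w (C a) = C a := (D.act w).commutes a

theorem flat_indep {J : Type*} [Fintype J] [DecidableEq J] (N : J → ι) (hN : Function.Injective N) {s : ℕ}
    (χ : G →* Matrix (Fin s) (Fin s) ℂ) (m : J → ℕ) (F : ∀ j, Fin s → Fin (d (N j)) → Po n)
    (hF : ∀ j, Flat D (rp π (N j)) χ (m j) (F j)) (x0 : Fin n → ℂ)
    (hx0 : ∀ H, eval x0 (D.α H) ≠ 0) (l : ∀ j, Fin (d (N j)) → ℂ)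
    (hl : ∀ b, ∑ j, ∑ a, l j a * eval x0 (F j b a) = 0) : ∀ j a, l j a = 0 := by
  have hG0 : ∀ b, ∑ j, ∑ a, C (l j a) * F j b a = 0 := by
    intro b
    refine flat_vanish (∏ H, D.α H) (Bm D χ) (fun b => ∑ j, ∑ a, C (l j a) * F j b a) ?_ x0 ?_ ?_ b
    · intro k b
      simp only [map_sum, Finset.mul_sum, pderiv_C_mul]
      rw [Finset.sum_comm]
      apply Finset.sum_congr rfl
      intro j _
      rw [Finset.sum_comm]
      apply Finset.sum_congr rfl
      intro a _
      have := congrFun ((hF j).flat k b) a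
      simp only [Pi.smul_apply, pd, smul_eq_mul, Finset.sum_apply] at this
      rw [mul_left_comm, this, Finset.mul_sum]
      apply Finset.sum_congr rfl
      intro c _
      ring
    · intro b
      simpa [map_sum] using hl b
    · rw [map_prod]
      exact Finset.prod_ne_zero_iff.mpr fun H _ => hx0 H
  have hw : ∀ (w : G) b, ∑ j, ∑ a, ∑ a', C (l j a * rp π (N j) w a a') * F j b a' = 0 := by
    intro w b
    have h1 : D.act w (∑ j, ∑ a, ∑ a', C (l j a * rp π (N j) w a a') * F j b a') = 0 := by
      have h2 : ∀ j a, D.act w (∑ a', C (l j a * rp π (N j) w a a') * F j b a')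
          = ∑ c, C (χ w c b) * (C (l j a) * F j c a) := by
        intro j a
        have := congrFun ((hF j).equiv w b) a
        simp only [dact_apply, Matrix.mulVec, dotProduct, cm, Matrix.map_apply, pact,
          Finset.sum_apply, Pi.smul_apply, MvPolynomial.smul_eq_C_mul] at this
        rw [map_sum]
        have h3 : ∀ a', D.act w (C (l j a * rp π (N j) w a a') * F j b a')
            = C (l j a) * (C (rp π (N j) w a a') * D.act w (F j b a')) := by
          intro a'
          rw [map_mul, act_C, C_mul, mul_assoc]
        simp only [h3]
        rw [← Finset.mul_sum, this, Finset.mul_sum]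
        apply Finset.sum_congr rfl
        intro c _
        ring
      simp only [map_sum (D.act w)] at h2 ⊢
      simp only [h2]
      have h4 : ∑ c, C (χ w c b) * (∑ j, ∑ a, C (l j a) * F j c a) = 0 := by
        simp [hG0]
      rw [← h4]
      simp only [Finset.mul_sum]
      rw [Finset.sum_comm' (t' := Finset.univ) (s' := fun _ => Finset.univ) (by simp)]
      apply Finset.sum_congr rfl
      intro c _
      rw [Finset.sum_comm]
    rw [← act_inv_act D w (∑ j, ∑ a, ∑ a', C (l j a * rp π (N j) w a a') * F j b a'), h1, map_zero]
  have hx : ∀ (x : MonoidAlgebra ℂ G) b, ∑ j, ∑ a, ∑ a', C (l j a * π x (N j) a a') * F j b a' = 0 := by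
    intro x b
    induction x using MonoidAlgebra.induction_on with
    | of w => exact hw w b
    | add x y hx hy =>
      simp only [map_add, Pi.add_apply, Matrix.add_apply, mul_add, add_mul, Finset.sum_add_distrib, C_add]
      rw [hx, hy, add_zero]
    | smul c x hx =>
      have : ∀ j a a', C (l j a * π (c • x) (N j) a a') * F j b a'
          = C c * (C (l j a * π x (N j) a a') * F j b a') := by
        intro j a a'
        rw [map_smul, Pi.smul_apply, Matrix.smul_apply, smul_eq_mul, mul_left_comm, C_mul, mul_assoc]
      simp only [this, ← Finset.mul_sum, hx, mul_zero]
  intro j0 a0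
  obtain ⟨b, hb⟩ := (hF j0).ne
  obtain ⟨a1, ha1⟩ : ∃ a1, F j0 b a1 ≠ 0 := by
    by_contra hcon
    push Not at hcon
    exact hb (by ext1 a; exact hcon a)
  have := hx (Eu π (N j0) a0 a1) b
  simp only [Eu, AlgEquiv.apply_symm_apply] at this
  rw [Finset.sum_eq_single_of_mem j0 (Finset.mem_univ _)] at this
  · rw [Finset.sum_eq_single_of_mem a0 (Finset.mem_univ _),
      Finset.sum_eq_single_of_mem a1 (Finset.mem_univ _)] at this
    · simp only [Pi.single_eq_same, Matrix.single_apply_same, mul_one] at this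
      have := (mul_eq_zero.mp this).resolve_right ha1
      simpa using this
    · intro a' _ ha'
      simp [Matrix.single_apply, ha'.symm]
    · intro a _ ha
      apply Finset.sum_eq_zero
      intro a' _
      simp [Matrix.single_apply, ha.symm]
  · intro j _ hj
    apply Finset.sum_eq_zero; intro a _
    apply Finset.sum_eq_zero; intro a' _
    rw [Pi.single_eq_of_ne (fun h => hj (hN h))]
    simp

theorem flat_count {J : Type*} [Fintype J] [DecidableEq J] (N : J → ι) (hN : Function.Injective N) {s : ℕ}
    (χ : G →* Matrix (Fin s) (Fin s) ℂ) (m : J → ℕ) (F : ∀ j, Fin s → Fin (d (N j)) → Po n)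
    (hF : ∀ j, Flat D (rp π (N j)) χ (m j) (F j)) (x0 : Fin n → ℂ)
    (hx0 : ∀ H, eval x0 (D.α H) ≠ 0) : ∑ j, d (N j) ≤ s := by
  let L : ((Σ j, Fin (d (N j))) → ℂ) →ₗ[ℂ] (Fin s → ℂ) :=
    { toFun := fun l b => ∑ j, ∑ a, l ⟨j, a⟩ * eval x0 (F j b a)
      map_add' := by
        intro l l'; ext1 b
        simp [add_mul, Finset.sum_add_distrib]
      map_smul' := by
        intro c l; ext1 b
        simp [Finset.mul_sum, mul_assoc] }
  have hL : Function.Injective L := by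
    rw [injective_iff_map_eq_zero]
    intro l hl
    ext1 ⟨j, a⟩
    exact flat_indep D π N hN χ m F hF x0 hx0 (fun j a => l ⟨j, a⟩) (fun b => congrFun hl b) j a
  have := LinearMap.finrank_le_finrank_of_injective hL
  simpa using this

end

section
variable {n : ℕ} {G : Type*} [Group G] {h : Type*} (D : RData n G h)
  [Fintype h] [DecidableEq h] {r : ℕ} (N χ : G →* Matrix (Fin r) (Fin r) ℂ)

def evM (y : Fin n → ℂ) (F : Fin r → Fin r → Po n) : Matrix (Fin r) (Fin r) ℂ :=
  Matrix.of fun a b => eval y (F b a)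

theorem eval_act (y : Fin n → ℂ) (w : G) (p : Po n) :
    eval y (D.act w p) = eval (fun k => eval y (D.act w (X k))) p := by
  induction p using MvPolynomial.induction_on with
  | C a => rw [act_C]; simp
  | add p q hp hq => simp [hp, hq]
  | mul_X p i hp => simp [hp]

theorem eval_smul_hom {p : Po n} {m : ℕ} (hp : p.IsHomogeneous m) (ζ : ℂ) (y : Fin n → ℂ) :
    eval (fun k => ζ * y k) p = ζ ^ m * eval y p := by
  rw [eval_eq', eval_eq', Finset.mul_sum]
  apply Finset.sum_congr rfl
  intro u hu
  have h1 := hp (mem_support_iff.mp hu)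
  have h2 : ∑ i, u i = m := by
    rw [← h1, Finsupp.weight_apply, Finsupp.sum_fintype _ _ (by simp)]
    simp
  simp only [mul_pow]
  rw [Finset.prod_mul_distrib, Finset.prod_pow_eq_pow_sum, h2]
  ring

theorem flat_trace {m : ℕ} {F : Fin r → Fin r → Po n} (hF : Flat D N χ m F) (y : Fin n → ℂ)
    (hdet : (evM y F).det ≠ 0) (w : G) (ζ : ℂ) (hw : ∀ k, eval y (D.act w (X k)) = ζ * y k) :
    ζ ^ m * (N w).trace = (χ w).trace := by
  have h1 : ζ ^ m • (N w * evM y F) = evM y F * χ w := by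
    ext a b
    have := congrArg (eval y) (congrFun (hF.equiv w b) a)
    simp only [dact_apply, Matrix.mulVec, dotProduct, cm, Matrix.map_apply, pact,
          Finset.sum_apply, Pi.smul_apply, MvPolynomial.smul_eq_C_mul, map_sum, map_mul, eval_C] at this
    simp only [Matrix.smul_apply, Matrix.mul_apply, evM, Matrix.of_apply, smul_eq_mul]
    rw [Finset.mul_sum]
    calc _ = ∑ x, N w a x * eval y (D.act w (F b x)) := by
          apply Finset.sum_congr rfl
          intro x _
          rw [eval_act]
          simp only [hw]
          rw [eval_smul_hom (hF.hm b x)]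
          ring
      _ = _ := by rw [this]; exact Finset.sum_congr rfl fun c _ => mul_comm _ _
  have hu : IsUnit (evM y F).det := isUnit_iff_ne_zero.mpr hdet
  have h2 : χ w = (evM y F)⁻¹ * (ζ ^ m • (N w * evM y F)) := by
    rw [h1, Matrix.nonsing_inv_mul_cancel_left _ _ hu]
  rw [h2, Matrix.mul_smul, Matrix.trace_smul, Matrix.trace_mul_comm, mul_assoc,
    Matrix.mul_nonsing_inv _ hu, mul_one, smul_eq_mul]

theorem flat_zero {F : Fin r → Fin r → Po n} (hF : Flat D N χ 0 F) (y : Fin n → ℂ)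
    (hdet : (evM y F).det ≠ 0) (H : h) : U D N H = 0 := by
  have h0 : ∀ b a, (cm (U D N H) *ᵥ F b) a = 0 := by
    intro b a
    obtain ⟨q, hq⟩ := (dvd_pow_self _ (e_pos D H).ne').trans (hF.inQ b H a)
    have h1 : ((cm (U D N H) *ᵥ F b) a).IsHomogeneous 0 := by
      simp only [Matrix.mulVec, dotProduct, cm, Matrix.map_apply]
      apply IsHomogeneous.sum
      intro c _
      exact (hF.hm b c).C_mul _
    rw [hq] at h1
    rw [hq, hom_mul_zero (D.α_hom H) (D.α_ne H) h1, mul_zero]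
  have h2 : U D N H * evM y F = 0 := by
    ext a b
    have := congrArg (eval y) (h0 b a)
    simpa [Matrix.mul_apply, evM, Matrix.mulVec, dotProduct, cm] using this
  have hu : IsUnit (evM y F).det := isUnit_iff_ne_zero.mpr hdet
  have := congrArg (· * (evM y F)⁻¹) h2
  simpa [mul_assoc, Matrix.mul_nonsing_inv _ hu] using this

def Qm (H : h) : Matrix (Fin r) (Fin r) ℂ := (D.e : ℂ)⁻¹ • U D N H

theorem e_ne (H : h) : (D.e : ℂ) ≠ 0 := Nat.cast_ne_zero.mpr (e_pos D H).ne'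

theorem Qm_idem (H : h) : Qm D N H * Qm D N H = Qm D N H := by
  have h1 : U D N H * U D N H = (D.e : ℂ) • U D N H := by
    nth_rewrite 1 [U_eq]
    rw [sub_mul, sum_mul_U]; simp
  rw [Qm, Matrix.smul_mul, Matrix.mul_smul, h1, smul_smul, smul_smul]
  congr 1
  rw [mul_assoc, inv_mul_cancel₀ (e_ne D H), mul_one]

/-- generic rank of `U_H` -/
theorem exists_kk (H : h) : ∃ k ≤ r, (U D N H).trace = (D.e : ℂ) * k ∧
    ∀ p : Po n, (1 + p • (cm (Qm D N H) : Matrix _ _ (Po n))).det = (1 + p) ^ k := by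
  obtain ⟨k, hk, ht, hd⟩ := idem_det (Qm D N H) (Qm_idem D N H)
  refine ⟨k, hk, ?_, fun p => hd n p⟩
  rw [← ht, Qm, Matrix.trace_smul, smul_eq_mul, mul_inv_cancel_left₀ (e_ne D H)]

def pM (F : Fin r → Fin r → Po n) : Matrix (Fin r) (Fin r) (Po n) := Matrix.of fun a b => F b a

theorem flat_dvd {m : ℕ} {F : Fin r → Fin r → Po n} (hF : Flat D N χ m F) (H : h) (k : ℕ)
    (hk : ∀ p : Po n, (1 + p • (cm (Qm D N H) : Matrix _ _ (Po n))).det = (1 + p) ^ k) :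
    D.α H ^ (D.e * k) ∣ (pM F).det := by
  obtain ⟨Ψ, hΨ⟩ : ∃ Ψ : Matrix (Fin r) (Fin r) (Po n), (cm (Qm D N H) : Matrix (Fin r) (Fin r) (Po n)) * pM F = D.α H ^ D.e • Ψ := by
    have h1 : ∀ a b, D.α H ^ D.e ∣ ((cm (Qm D N H) : Matrix (Fin r) (Fin r) (Po n)) * pM F) a b := by
      intro a b
      have h2 : ((cm (Qm D N H) : Matrix (Fin r) (Fin r) (Po n)) * pM F) a b = C (D.e : ℂ)⁻¹ * (cm (U D N H) *ᵥ F b) a := by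
        simp only [Matrix.mul_apply, pM, Matrix.of_apply, Matrix.mulVec, dotProduct, cm, Matrix.map_apply,
          Qm, Matrix.smul_apply, smul_eq_mul, C_mul, Finset.mul_sum, mul_assoc]
      rw [h2]
      exact (hF.inQ b H a).mul_left _
    choose Ψ hΨ using h1
    exact ⟨Matrix.of Ψ, by ext1 a b; simp [hΨ a b]⟩
  set Q : Matrix (Fin r) (Fin r) (Po n) := cm (Qm D N H) with hQ
  have hQQ : Q * Q = Q := by
    rw [hQ]; exact (cm_mul _ _).symm.trans (by rw [Qm_idem])
  have h3 : pM F = (1 + (D.α H ^ D.e - 1) • Q) * ((1 - Q) * pM F + Q * Ψ) := by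
    have h4 : Q * Q * pM F = D.α H ^ D.e • (Q * Ψ) := by
      rw [mul_assoc, hΨ, Matrix.mul_smul]
    rw [hQQ] at h4
    have h5 : Q * ((1 - Q) * pM F) = 0 := by
      rw [← mul_assoc, mul_sub, mul_one, hQQ, sub_self, zero_mul]
    rw [add_mul, one_mul, Matrix.smul_mul, mul_add, h5, ← mul_assoc Q Q, hQQ, zero_add, sub_smul,
      one_smul, sub_mul, one_mul, h4]
    abel
  rw [h3, Matrix.det_mul, hk, add_sub_cancel, ← pow_mul]
  exact Dvd.intro _ rfl

theorem eval_pM_det (y : Fin n → ℂ) (F : Fin r → Fin r → Po n) :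
    eval y (pM F).det = (evM y F).det := by
  rw [RingHom.map_det]; rfl

theorem flat_deg {m : ℕ} {F : Fin r → Fin r → Po n} (hF : Flat D N χ m F) (y : Fin n → ℂ)
    (hdet : (evM y F).det ≠ 0) : ∃ K : ℕ, ∑ H, (U D N H).trace = K ∧ K ≤ r * m ∧
      K ≤ r * (D.e * Fintype.card h) := by
  choose k hkr hkt hk using exists_kk D N
  have hd0 : (pM F).det ≠ 0 := by
    intro h0
    rw [← eval_pM_det, h0, map_zero] at hdet
    exact hdet rfl
  refine ⟨∑ H, D.e * k H, ?_, ?_, ?_⟩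
  · push_cast; exact Finset.sum_congr rfl fun H _ => hkt H
  · have h1 : ∏ H, D.α H ^ (D.e * k H) ∣ (pM F).det := by
      apply Finset.prod_dvd_of_isRelPrime
      · intro H _ H' _ hne
        apply IsRelPrime.pow
        rw [(prime_lin (D.α_hom H) (D.α_ne H)).irreducible.isRelPrime_iff_not_dvd]
        exact D.α_ndvd H H' hne
      · intro H _; exact flat_dvd D N χ hF H _ (hk H)
    have h2 : (∏ H, D.α H ^ (D.e * k H)).IsHomogeneous (∑ H, 1 * (D.e * k H)) := by
      apply IsHomogeneous.prod
      intro H _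
      exact (D.α_hom H).pow _
    have h3 : ((pM F).det).IsHomogeneous (r * m) := by
      rw [Matrix.det_apply]
      apply IsHomogeneous.sum
      intro σ _
      have h4 : (∏ i, pM F (σ i) i).IsHomogeneous (∑ i : Fin r, m) := by
        apply IsHomogeneous.prod
        intro i _
        exact hF.hm _ _
      have h5 : (Equiv.Perm.sign σ • ∏ i, pM F (σ i) i) = C ((Equiv.Perm.sign σ : ℤ) : ℂ) * ∏ i, pM F (σ i) i := by
        rw [Units.smul_def, zsmul_eq_mul]; simp
      rw [h5]
      simpa using h4.C_mul ((Equiv.Perm.sign σ : ℤ) : ℂ)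
    obtain ⟨q, hq⟩ := h1
    have h6 : (∏ H, D.α H ^ (D.e * k H)) ≠ 0 := fun h0 => hd0 (by rw [hq, h0, zero_mul])
    have h7 : q ≠ 0 := fun h0 => hd0 (by rw [hq, h0, mul_zero])
    have h8 := totalDegree_mul_of_isDomain h6 h7
    rw [← hq, h3.totalDegree hd0, h2.totalDegree h6] at h8
    simp only [one_mul] at h8
    omega
  · calc ∑ H, D.e * k H ≤ ∑ H : h, D.e * r := by
          apply Finset.sum_le_sum; intro H _; exact Nat.mul_le_mul_left _ (hkr H)
      _ = _ := by simp; ring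

end
end WFF

namespace WFF
open MvPolynomial
open scoped Matrix

section
variable {n : ℕ} {G : Type*} [Group G] {h : Type*} (D : RData n G h)
  [Fintype h] [DecidableEq h]
  {ι : Type*} [Fintype ι] [DecidableEq ι] {d : ι → ℕ}
  (π : MonoidAlgebra ℂ G ≃ₐ[ℂ] ∀ i, Matrix (Fin (d i)) (Fin (d i)) ℂ)

theorem scalar_of_commute (i : ι) (A : Matrix (Fin (d i)) (Fin (d i)) ℂ)
    (hA : ∀ w, A * rp π i w = rp π i w * A) : ∃ c : ℂ, A = c • 1 := by
  have h1 : ∀ x : MonoidAlgebra ℂ G, A * π x i = π x i * A := by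
    intro x
    induction x using MonoidAlgebra.induction_on with
    | of w => exact hA w
    | add x y hx hy => rw [map_add, Pi.add_apply, mul_add, add_mul, hx, hy]
    | smul c x hx => rw [map_smul, Pi.smul_apply, Matrix.mul_smul, Matrix.smul_mul, hx]
  have h2 : ∀ M, A * M = M * A := by
    intro M
    have := h1 (π.symm (Pi.single i M))
    simpa using this
  have h3 : A ∈ Set.range (Matrix.scalar (Fin (d i))) := by
    rw [Matrix.mem_range_scalar_iff_commute_single']
    intro a b
    exact (h2 _).symm
  obtain ⟨c, rfl⟩ := h3
  exact ⟨c, by rw [Matrix.smul_one_eq_diagonal]; rfl⟩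

def mvE (w : G) : h ≃ h where
  toFun := D.mv w
  invFun := D.mv w⁻¹
  left_inv H := by have := D.mv_inv w⁻¹ H; rwa [inv_inv] at this
  right_inv H := D.mv_inv w H

theorem total_scalar (i : ι) : ∃ c : ℂ, ∑ H, U D (rp π i) H = c • 1 := by
  apply scalar_of_commute π
  intro w
  rw [Finset.sum_mul, Finset.mul_sum]
  simp only [U_conj]
  exact Equiv.sum_comp (mvE D w⁻¹) (fun H => rp π i w * U D (rp π i) H)

theorem exists_good : ∃ y : Fin n → ℂ, ∀ H, eval y (D.α H) ≠ 0 := by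
  by_contra hcon
  push Not at hcon
  have h0 : ∏ H, D.α H = 0 := by
    apply MvPolynomial.funext
    intro y
    obtain ⟨H, hH⟩ := hcon y
    rw [map_zero, map_prod]
    exact Finset.prod_eq_zero (Finset.mem_univ H) hH
  exact Finset.prod_ne_zero_iff.mpr (fun H _ => D.α_ne H) h0

theorem flat_pack {r s : ℕ} (hrs : s = r) (N : G →* Matrix (Fin r) (Fin r) ℂ)
    (χ : G →* Matrix (Fin s) (Fin s) ℂ) (m : ℕ) (F : Fin s → Fin r → Po n)
    (hF : Flat D N χ m F) (hLI : ∀ y, (∀ H, eval y (D.α H) ≠ 0) → ∀ l : Fin r → ℂ,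
      (∀ b, ∑ a, l a * eval y (F b a) = 0) → ∀ a, l a = 0) :
    (∀ y, (∀ H, eval y (D.α H) ≠ 0) → ∀ w ζ, (∀ k, eval y (D.act w (X k)) = ζ * y k) →
      ζ ^ m * (N w).trace = (χ w).trace) ∧
    (m = 0 → ∀ H, U D N H = 0) ∧
    (∃ K : ℕ, ∑ H, (U D N H).trace = K ∧ K ≤ r * m ∧ K ≤ r * (D.e * Fintype.card h)) := by
  subst hrs
  have hdet : ∀ y, (∀ H, eval y (D.α H) ≠ 0) → (evM y F).det ≠ 0 := by
    intro y hy h0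
    obtain ⟨l, hl, hl0⟩ := Matrix.exists_vecMul_eq_zero_iff.mpr h0
    apply hl
    ext1 a
    exact hLI y hy l (fun b => congrFun hl0 b) a
  obtain ⟨y0, hy0⟩ := exists_good D
  refine ⟨fun y hy w ζ hw => flat_trace D N χ hF y (hdet y hy) w ζ hw, ?_, flat_deg D N χ hF y0 (hdet y0 hy0)⟩
  rintro rfl H
  exact flat_zero D N χ hF y0 (hdet y0 hy0) H

theorem core (hd : ∀ i, 0 < d i) : ∃ (Φ : Equiv.Perm ι) (c : ι → ℕ),
    (∀ i, ∑ H, U D (rp π i) H = (c i : ℂ) • 1) ∧ (∀ i, c (Φ i) = c i) ∧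
    (∀ i, c i ≤ D.e * Fintype.card h) ∧ (∀ i, d (Φ i) = d i) ∧
    (∀ i, c i = 0 → ∀ H, U D (rp π i) H = 0) ∧
    (∀ y, (∀ H, eval y (D.α H) ≠ 0) → ∀ w ζ, (∀ k, eval y (D.act w (X k)) = ζ * y k) →
      ∀ i, ζ ^ (c i) * (rp π i w).trace = (rp π (Φ i) w).trace) := by
  choose Φ m F hF using fun i => exists_flat D (rp π i) π (hd i)
  obtain ⟨y0, hy0⟩ := exists_good D
  have hle : ∀ χ, ∑ i with Φ i = χ, d i ≤ d χ := by
    intro χ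
    have hex : ∀ j : {i // Φ i = χ}, ∃ m F, Flat D (rp π j.1) (rp π χ) m F := by
      rintro ⟨i, rfl⟩; exact ⟨m i, F i, hF i⟩
    choose m' F' hF' using hex
    have := flat_count D π (fun j : {i // Φ i = χ} => j.1) Subtype.val_injective (rp π χ) m' F' hF' y0 hy0
    rw [← Finset.sum_subtype_eq_sum_filter, Finset.subtype_univ]
    exact this
  have heq : ∀ χ, ∑ i with Φ i = χ, d i = d χ := by
    have h1 : ∑ χ, ∑ i with Φ i = χ, d i = ∑ χ, d χ := Finset.sum_fiberwise _ _ _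
    have := (Finset.sum_eq_sum_iff_of_le (fun χ _ => hle χ)).mp h1
    exact fun χ => this χ (Finset.mem_univ _)
  have hsurj : Function.Surjective Φ := by
    intro χ
    have h1 := heq χ
    by_contra hcon
    push Not at hcon
    rw [Finset.filter_false_of_mem (fun i _ => hcon i), Finset.sum_empty] at h1
    exact (hd χ).ne h1
  have hbij : Function.Bijective Φ := Finite.surjective_iff_bijective.mp hsurj
  have hdim : ∀ i, d (Φ i) = d i := by
    intro i
    rw [← heq (Φ i), Finset.sum_eq_single_of_mem i (by simp)]
    intro b hb hbi
    exact absurd (hbij.1 (Finset.mem_filter.mp hb).2) hbi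
  have hpack := fun i => flat_pack D (hdim i) (rp π i) (rp π (Φ i)) (m i) (F i) (hF i) (by
    intro y hy l hl a
    exact flat_indep D π (fun _ : Unit => i) (fun _ _ _ => rfl) (rp π (Φ i)) (fun _ => m i)
      (fun _ => F i) (fun _ => hF i) y hy (fun _ => l) (fun b => by simpa using hl b) () a)
  choose cc hcc using total_scalar D π
  have hcm : ∀ i, cc (Φ i) = m i := by
    intro i
    obtain ⟨b, hb⟩ := (hF i).ne
    have h1 := (hF i).euler b
    rw [hcc] at h1
    have h2 : ∑ c, (cc (Φ i) • (1 : Matrix (Fin (d (Φ i))) (Fin (d (Φ i))) ℂ)) c b • F i c = cc (Φ i) • F i b := by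
      simp [Matrix.one_apply]
    rw [h2] at h1
    exact (smul_left_injective ℂ hb h1).symm
  let Φe : Equiv.Perm ι := Equiv.ofBijective Φ hbij
  let c : ι → ℕ := fun i => m (Φe.symm i)
  have hΦs : ∀ i, Φ (Φe.symm i) = i := fun i => Φe.apply_symm_apply i
  have hΦs' : ∀ i, Φe.symm (Φ i) = i := fun i => Φe.symm_apply_apply i
  have hcΦ : ∀ i, c (Φ i) = m i := fun i => by simp only [c, hΦs']
  have hccc : ∀ i, cc i = c i := by
    intro i
    have := hcm (Φe.symm i)
    rwa [hΦs] at this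
  have hK : ∀ i, d i * c i ≤ d i * m i ∧ d i * c i ≤ d i * (D.e * Fintype.card h) := by
    intro i
    obtain ⟨K, hK, h1, h2⟩ := (hpack i).2.2
    have h3 : (K : ℂ) = (d i * c i : ℕ) := by
      rw [← hK, ← Matrix.trace_sum, hcc, hccc, Matrix.trace_smul]; simp [mul_comm]
    have h4 : K = d i * c i := by exact_mod_cast h3
    rw [h4] at h1 h2
    exact ⟨h1, h2⟩
  have hcm' : ∀ i, c i ≤ m i := fun i => Nat.le_of_mul_le_mul_left (hK i).1 (hd i)
  have hsum : ∑ i, c i = ∑ i, m i := Equiv.sum_comp Φe.symm m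
  have hceq : ∀ i, c i = m i := fun i =>
    (Finset.sum_eq_sum_iff_of_le (fun i _ => hcm' i)).mp hsum i (Finset.mem_univ _)
  refine ⟨Φe, c, ?_, ?_, ?_, ?_, ?_, ?_⟩
  · intro i; rw [hcc, hccc]
  · intro i; exact (hcΦ i).trans (hceq i).symm
  · intro i; exact Nat.le_of_mul_le_mul_left (hK i).2 (hd i)
  · intro i; exact hdim i
  · intro i hi; rw [hceq] at hi; exact (hpack i).2.1 hi
  · intro y hy w ζ hw i
    rw [hceq]; exact (hpack i).1 y hy w ζ hw

end
end WFF

namespace WFF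
open MvPolynomial
open scoped Matrix

section geometry
variable {V : Type*} [AddCommGroup V] [Module ℂ V] [FiniteDimensional ℂ V]
  (W : Subgroup (V →ₗ[ℂ] V)ˣ)

theorem toLin_mul (v w : W) : toLin W (v * w) = toLin W v ∘ₗ toLin W w := rfl
theorem toLin_one : toLin W 1 = LinearMap.id := rfl
theorem toLin_mul_apply (v w : W) (x : V) : toLin W (v * w) x = toLin W v (toLin W w x) := rfl
theorem toLin_inv_apply (w : W) (x : V) : toLin W w⁻¹ (toLin W w x) = x := by
  rw [← toLin_mul_apply, inv_mul_cancel, toLin_one]; rfl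
theorem toLin_apply_inv (w : W) (x : V) : toLin W w (toLin W w⁻¹ x) = x := by
  rw [← toLin_mul_apply, mul_inv_cancel, toLin_one]; rfl

theorem mem_fixedSpace (w : W) (x : V) : x ∈ fixedSpace (w : (V →ₗ[ℂ] V)ˣ) ↔ toLin W w x = x := by
  simp [fixedSpace, toLin, sub_eq_zero]

/-- linear form as polynomial -/
def lin {n : ℕ} (b : Module.Basis (Fin n) ℂ V) (l : V →ₗ[ℂ] ℂ) : Po n := ∑ j, C (l (b j)) * X j

section
variable {n : ℕ} (b : Module.Basis (Fin n) ℂ V)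

theorem lin_hom (l : V →ₗ[ℂ] ℂ) : (lin b l).IsHomogeneous 1 := by
  apply IsHomogeneous.sum
  intro j _
  exact (isHomogeneous_X _ _).C_mul _

theorem eval_lin (l : V →ₗ[ℂ] ℂ) (v : V) : eval (fun i => b.repr v i) (lin b l) = l v := by
  conv_rhs => rw [← b.sum_repr v, map_sum]
  simp only [lin, map_sum, map_mul, eval_C, eval_X, map_smul, smul_eq_mul, mul_comm]

theorem lin_smul (c : ℂ) (l : V →ₗ[ℂ] ℂ) : lin b (c • l) = C c * lin b l := by
  simp [lin, Finset.mul_sum, mul_assoc]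

theorem lin_sub (l l' : V →ₗ[ℂ] ℂ) : lin b (l - l') = lin b l - lin b l' := by
  simp [lin, sub_mul, Finset.sum_sub_distrib]

theorem lin_coord (i : Fin n) : lin b (b.coord i) = X i := by
  rw [lin, Finset.sum_eq_single_of_mem i (Finset.mem_univ _)]
  · simp
  · intro j _ hj
    simp [Finsupp.single_apply, hj]

theorem lin_ne {l : V →ₗ[ℂ] ℂ} (hl : l ≠ 0) : lin b l ≠ 0 := by
  intro h0
  apply hl
  ext v
  rw [← eval_lin b, h0]; simp

def actw (w : W) : Po n →ₐ[ℂ] Po n := aeval (fun i => lin b (b.coord i ∘ₗ toLin W w⁻¹))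

theorem actw_lin (w : W) (l : V →ₗ[ℂ] ℂ) : actw W b w (lin b l) = lin b (l ∘ₗ toLin W w⁻¹) := by
  have h1 : ∀ j, actw W b w (C (l (b j)) * X j) = C (l (b j)) * lin b (b.coord j ∘ₗ toLin W w⁻¹) := by
    intro j
    rw [map_mul, actw, aeval_X]
    congr 1
    exact (actw W b w).commutes _
  rw [lin, map_sum]
  simp only [h1, lin, Finset.mul_sum]
  rw [Finset.sum_comm]
  apply Finset.sum_congr rfl
  intro k _
  simp only [← mul_assoc]
  rw [← Finset.sum_mul]
  congr 1
  simp only [← C_mul]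
  rw [← map_sum]
  congr 1
  conv_rhs => rw [LinearMap.comp_apply, ← b.sum_repr (toLin W w⁻¹ (b k)), map_sum]
  simp only [LinearMap.comp_apply, map_smul, smul_eq_mul, Module.Basis.coord_apply, mul_comm]

def actH : W →* (Po n →ₐ[ℂ] Po n) where
  toFun := actw W b
  map_one' := by
    apply MvPolynomial.algHom_ext
    intro i
    rw [← lin_coord b, actw_lin]
    simp [toLin_one]
  map_mul' v w := by
    apply MvPolynomial.algHom_ext
    intro i
    rw [← lin_coord b, AlgHom.mul_apply, actw_lin, actw_lin, actw_lin, mul_inv_rev, toLin_mul]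
    rfl

end

theorem hyp_form (H : Submodule ℂ V) (hH : Module.finrank ℂ V = Module.finrank ℂ H + 1) :
    ∃ l : V →ₗ[ℂ] ℂ, l ≠ 0 ∧ LinearMap.ker l = H := by
  have hlt : H < ⊤ := by
    rw [lt_top_iff_ne_top]; rintro rfl
    rw [finrank_top] at hH; omega
  obtain ⟨l, hl, hle⟩ := H.exists_le_ker_of_lt_top hlt
  refine ⟨l, hl, (Submodule.eq_of_le_of_finrank_le hle ?_).symm⟩
  have h1 : LinearMap.ker l < ⊤ := by
    rw [lt_top_iff_ne_top]; intro h; exact hl (LinearMap.ker_eq_top.mp h)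
  have := Submodule.finrank_lt h1.ne
  omega

theorem form_smul {l f : V →ₗ[ℂ] ℂ} (hl : l ≠ 0) (h : LinearMap.ker l ≤ LinearMap.ker f) :
    ∃ c : ℂ, f = c • l := by
  obtain ⟨u, hu⟩ : ∃ u, l u ≠ 0 := by
    by_contra hcon; push Not at hcon; exact hl (LinearMap.ext hcon)
  refine ⟨f u / l u, ?_⟩
  ext x
  have h1 : x - (l x / l u) • u ∈ LinearMap.ker l := by
    simp [hu]
  have h2 := h h1
  simp only [LinearMap.mem_ker, map_sub, map_smul, smul_eq_mul, sub_eq_zero] at h2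
  rw [h2]; simp; ring

theorem arr_finrank {H : Submodule ℂ V} (hH : H ∈ arrangement W) :
    Module.finrank ℂ V = Module.finrank ℂ H + 1 := by
  obtain ⟨t, ht, rfl⟩ := hH; exact ht

def formOf (H : Submodule ℂ V) (hH : H ∈ arrangement W) : V →ₗ[ℂ] ℂ :=
  (hyp_form H (arr_finrank W hH)).choose

theorem formOf_ne (H : Submodule ℂ V) (hH : H ∈ arrangement W) : formOf W H hH ≠ 0 :=
  (hyp_form H (arr_finrank W hH)).choose_spec.1

theorem ker_formOf (H : Submodule ℂ V) (hH : H ∈ arrangement W) : LinearMap.ker (formOf W H hH) = H :=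
  (hyp_form H (arr_finrank W hH)).choose_spec.2

theorem formOf_zero (H : Submodule ℂ V) (hH : H ∈ arrangement W) (v : V) :
    formOf W H hH v = 0 ↔ v ∈ H := by
  rw [← LinearMap.mem_ker, ker_formOf]

def PS (H : Submodule ℂ V) : Subgroup W where
  carrier := ptStab W H
  one_mem' := fun v _ => rfl
  mul_mem' := fun {a b} ha hb v hv => by rw [toLin_mul_apply, hb v hv, ha v hv]
  inv_mem' := fun {a} ha v hv => by
    conv_lhs => rw [← ha v hv]
    exact toLin_inv_apply W a v

variable [Fintype W]

open Classical in
def mkData {n : ℕ} (b : Module.Basis (Fin n) ℂ V) (Cs : Set (Submodule ℂ V)) (e : ℕ)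
    (hC : ∀ H ∈ Cs, H ∈ arrangement W) (hmap : ∀ (w : W), ∀ H ∈ Cs, H.map (toLin W w) ∈ Cs)
    (he : ∀ H ∈ Cs, (ptStab W H).ncard = e) : RData n W Cs where
  act := actH W b
  act_hom w i := by
    rw [← lin_coord b]
    change (actw W b w _).IsHomogeneous 1
    rw [actw_lin]; exact lin_hom b _
  α H := lin b (formOf W H.1 (hC _ H.2))
  α_hom H := lin_hom b _
  α_ne H := lin_ne b (formOf_ne W _ _)
  α_ndvd H H' hne := by
    rintro ⟨q, hq⟩
    apply hne
    apply Subtype.ext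
    apply Submodule.eq_of_le_of_finrank_le
    · intro v hv
      rw [← formOf_zero W _ (hC _ H'.2), ← eval_lin b, hq, map_mul, eval_lin,
        (formOf_zero W _ (hC _ H.2) v).mpr hv, zero_mul]
    · have h1 := arr_finrank W (hC _ H.2)
      have h2 := arr_finrank W (hC _ H'.2)
      omega
  St H := Finset.univ.filter (fun t => t ∈ ptStab W H.1)
  e := e
  card_St H := by
    rw [← he H.1 H.2, Set.ncard_eq_toFinset_card']
    congr 1; ext t; simp
  one_St H := by
    simp only [Finset.mem_filter, Finset.mem_univ, true_and]
    exact (PS W H.1).one_mem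
  mul_St H s hs t ht := by
    simp only [Finset.mem_filter, Finset.mem_univ, true_and] at *
    exact (PS W H.1).mul_mem hs ht
  inv_St H s hs := by
    simp only [Finset.mem_filter, Finset.mem_univ, true_and] at *
    exact (PS W H.1).inv_mem hs
  act_St H t ht i := by
    simp only [Finset.mem_filter, Finset.mem_univ, true_and] at ht
    rw [← lin_coord b]
    change _ ∣ actw W b t _ - _
    rw [actw_lin, ← lin_sub]
    obtain ⟨c, hc⟩ := form_smul (f := b.coord i ∘ₗ toLin W t⁻¹ - b.coord i)
      (formOf_ne W H.1 (hC _ H.2)) (by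
        intro v hv
        rw [ker_formOf] at hv
        have := (PS W H.1).inv_mem ht v hv
        rw [LinearMap.mem_ker, LinearMap.sub_apply, LinearMap.comp_apply, this, sub_self])
    rw [hc, lin_smul]
    exact Dvd.intro_left _ rfl
  act_St_pow H t ht := by
    simp only [Finset.mem_filter, Finset.mem_univ, true_and] at ht
    set l := formOf W H.1 (hC _ H.2) with hl
    obtain ⟨c, hc⟩ := form_smul (f := l ∘ₗ toLin W t⁻¹)
      (formOf_ne W H.1 (hC _ H.2)) (by
        intro v hv
        have hv' := hv
        rw [ker_formOf] at hv
        have := (PS W H.1).inv_mem ht v hv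
        rw [LinearMap.mem_ker, LinearMap.comp_apply, this]; exact hv')
    have h1 : actH W b t (lin b l) = C c * lin b l := by
      change actw W b t _ = _
      rw [actw_lin, hc, lin_smul]
    have h2 : ∀ k, actH W b (t ^ k) (lin b l) = C (c ^ k) * lin b l := by
      intro k
      induction k with
      | zero => simp
      | succ k ih =>
        rw [pow_succ, map_mul, AlgHom.mul_apply, h1, map_mul, ih, pow_succ, C_mul]
        have : actH W b (t ^ k) (C c) = C c := (actH W b (t ^ k)).commutes c
        rw [this]; ring
    have h3 : t ^ e = 1 := by
      have h4 : orderOf t ∣ Nat.card (PS W H.1) := Subgroup.orderOf_dvd_natCard _ ht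
      have h5 : Nat.card (PS W H.1) = e := he H.1 H.2
      rw [h5] at h4
      exact orderOf_dvd_iff_pow_eq_one.mp h4
    have h4 : c ^ e = 1 := by
      have h5 := h2 e
      rw [h3, map_one, AlgHom.one_apply] at h5
      have h6 : (C (c ^ e - 1) : Po n) * lin b l = 0 := by
        rw [C_sub, sub_mul, ← h5, C_1]; ring
      have h7 := (mul_eq_zero.mp h6).resolve_right (lin_ne b (formOf_ne W _ _))
      rw [C_eq_zero, sub_eq_zero] at h7
      exact h7
    rw [h1, mul_pow, ← C_pow, h4, C_1, one_mul]
  mv w H := ⟨H.1.map (toLin W w), hmap w H.1 H.2⟩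
  act_α w H := by
    set l := formOf W H.1 (hC _ H.2) with hl
    obtain ⟨c, hc⟩ := form_smul (f := l ∘ₗ toLin W w⁻¹)
      (formOf_ne W (H.1.map (toLin W w)) (hC _ (hmap w H.1 H.2))) (by
        intro v hv
        rw [ker_formOf] at hv
        obtain ⟨u, hu, rfl⟩ := hv
        rw [LinearMap.mem_ker, LinearMap.comp_apply, toLin_inv_apply]
        exact (formOf_zero W _ (hC _ H.2) u).mpr hu)
    refine ⟨c, ?_⟩
    change actw W b w _ = _
    rw [actw_lin, hc, lin_smul]
  mv_inv w H := by
    apply Subtype.ext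
    change (H.1.map (toLin W w⁻¹)).map (toLin W w) = H.1
    rw [← Submodule.map_comp, ← toLin_mul, mul_inv_cancel, toLin_one, Submodule.map_id]
  conj_St w H t ht := by
    simp only [Finset.mem_filter, Finset.mem_univ, true_and] at *
    rintro v ⟨u, hu, rfl⟩
    rw [toLin_mul_apply, toLin_inv_apply, toLin_mul_apply, ht u hu]

open Classical in
/-- the reflections with hyperplane in `Cs` -/
def Cr (Cs : Set (Submodule ℂ V)) : Finset W :=
  Finset.univ.filter fun t => t ∈ refls W ∧ fixedSpace (t : (V →ₗ[ℂ] V)ˣ) ∈ Cs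

theorem fixed_eq {H : Submodule ℂ V} (hH : H ∈ arrangement W) {t : W} :
    (t ∈ refls W ∧ fixedSpace (t : (V →ₗ[ℂ] V)ˣ) = H) ↔ (t ≠ 1 ∧ t ∈ ptStab W H) := by
  have hf := arr_finrank W hH
  constructor
  · rintro ⟨h1, rfl⟩
    refine ⟨?_, fun v hv => (mem_fixedSpace W t v).mp hv⟩
    rintro rfl
    have : fixedSpace ((1 : W) : (V →ₗ[ℂ] V)ˣ) = ⊤ := by
      rw [eq_top_iff]; intro v _; rw [mem_fixedSpace]; rfl
    rw [this, finrank_top] at hf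
    omega
  · rintro ⟨h1, h2⟩
    have hle : H ≤ fixedSpace (t : (V →ₗ[ℂ] V)ˣ) := fun v hv => (mem_fixedSpace W t v).mpr (h2 v hv)
    have hlt : fixedSpace (t : (V →ₗ[ℂ] V)ˣ) < ⊤ := by
      rw [lt_top_iff_ne_top]
      intro h3
      apply h1
      apply Subtype.ext
      apply Units.ext
      apply LinearMap.ext
      intro v
      have : v ∈ fixedSpace (t : (V →ₗ[ℂ] V)ˣ) := by rw [h3]; trivial
      exact (mem_fixedSpace W t v).mp this
    have h4 := Submodule.finrank_lt hlt.ne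
    have h5 := Submodule.eq_of_le_of_finrank_le hle (by omega)
    refine ⟨?_, h5.symm⟩
    change _ = _ + 1
    rw [← h5]; exact hf

open Classical in
theorem sum_Cr {M : Type*} [AddCommGroup M] {n : ℕ} (b : Module.Basis (Fin n) ℂ V)
    (Cs : Set (Submodule ℂ V)) [Fintype Cs] (e : ℕ)
    (hC : ∀ H ∈ Cs, H ∈ arrangement W) (hmap : ∀ (w : W), ∀ H ∈ Cs, H.map (toLin W w) ∈ Cs)
    (he : ∀ H ∈ Cs, (ptStab W H).ncard = e) (f : W → M) (hf : f 1 = 0) :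
    ∑ H : Cs, ∑ t ∈ (mkData W b Cs e hC hmap he).St H, f t = ∑ t ∈ Cr W Cs, f t := by
  rw [← Finset.sum_fiberwise_of_maps_to (s := Cr W Cs) (t := Cs.toFinset)
    (g := fun t => fixedSpace (t : (V →ₗ[ℂ] V)ˣ))]
  · rw [← Finset.sum_coe_sort Cs.toFinset]
    refine Fintype.sum_equiv (Equiv.subtypeEquivRight (by simp)) _ _ ?_
    rintro ⟨H, hH⟩
    simp only [mkData, Equiv.subtypeEquivRight_apply_coe]
    rw [← Finset.sum_filter_ne_zero]
    symm
    rw [← Finset.sum_filter_ne_zero]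
    apply Finset.sum_congr _ (fun _ _ => rfl)
    ext t
    have := fixed_eq W (hC H hH) (t := t)
    simp only [Finset.mem_filter, Finset.mem_univ, true_and, Cr]
    constructor
    · rintro ⟨⟨⟨h1, h2⟩, h3⟩, h4⟩
      exact ⟨(this.mp ⟨h1, h3⟩).2, h4⟩
    · rintro ⟨h1, h2⟩
      have h3 := this.mpr ⟨fun h => h2 (h ▸ hf), h1⟩
      exact ⟨⟨⟨h3.1, h3.2 ▸ hH⟩, h3.2⟩, h2⟩
  · intro t ht
    simp only [Cr, Finset.mem_filter] at ht
    simpa using ht.2.2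

end geometry
end WFF

namespace WFF
open MvPolynomial
open scoped Matrix

section geometry2
variable {V : Type*} [AddCommGroup V] [Module ℂ V] [FiniteDimensional ℂ V]
  (W : Subgroup (V →ₗ[ℂ] V)ˣ) [Fintype W]
  {ι : Type*} [Fintype ι] [DecidableEq ι] {d : ι → ℕ}
  (π : MonoidAlgebra ℂ W ≃ₐ[ℂ] ∀ i, Matrix (Fin (d i)) (Fin (d i)) ℂ)

theorem card_Cr (Cs : Set (Submodule ℂ V)) (hfin : Cs.Finite) (e : ℕ)
    (hC : ∀ H ∈ Cs, H ∈ arrangement W) (hmap : ∀ (w : W), ∀ H ∈ Cs, H.map (toLin W w) ∈ Cs)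
    (he : ∀ H ∈ Cs, (ptStab W H).ncard = e) :
    ((Cr W Cs).card : ℤ) = Cs.ncard * ((e : ℤ) - 1) := by
  classical
  haveI := hfin.fintype
  let b := Module.finBasis ℂ V
  have h1 := sum_Cr W b Cs e hC hmap he (fun t => if t = 1 then (0 : ℤ) else 1) (by simp)
  have h2 : ∑ t ∈ Cr W Cs, (if t = 1 then (0 : ℤ) else 1) = (Cr W Cs).card := by
    rw [Finset.card_eq_sum_ones]
    push_cast
    apply Finset.sum_congr rfl
    intro t ht
    rw [if_neg]
    simp only [Cr, Finset.mem_filter] at ht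
    exact ((fixed_eq W (hC _ ht.2.2)).mp ⟨ht.2.1, rfl⟩).1
  rw [← h2, ← h1, Set.ncard_eq_toFinset_card', Set.toFinset_card]
  have h3 : ∀ H : Cs, ∑ t ∈ (mkData W b Cs e hC hmap he).St H, (if t = 1 then (0 : ℤ) else 1) = (e : ℤ) - 1 := by
    intro H
    set D := mkData W b Cs e hC hmap he
    have h4 : ∀ t : W, (if t = 1 then (0 : ℤ) else 1) = 1 - if t = 1 then (1:ℤ) else 0 := by
      intro t; split_ifs <;> simp
    simp only [h4, Finset.sum_sub_distrib, Finset.sum_ite_eq', D.one_St H, if_true]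
    rw [Finset.sum_const, D.card_St]
    simp [D, mkData]
  simp only [h3, Finset.sum_const, Finset.card_univ, nsmul_eq_mul]

theorem geo (hd : ∀ i, 0 < d i) (g : W) (ζ : ℂ) (v : V) (hgv : toLin W g v = ζ • v)
    (hv : ∀ H ∈ arrangement W, v ∉ H) (Cs : Set (Submodule ℂ V)) (hfin : Cs.Finite) (e : ℕ)
    (hC : ∀ H ∈ Cs, H ∈ arrangement W) (hmap : ∀ (w : W), ∀ H ∈ Cs, H.map (toLin W w) ∈ Cs)
    (he : ∀ H ∈ Cs, (ptStab W H).ncard = e) :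
    ∃ (Φ : Equiv.Perm ι) (c : ι → ℕ),
    (∀ i, ∑ t ∈ Cr W Cs, rp π i t = (((Cr W Cs).card : ℂ) - c i) • 1) ∧ (∀ i, c (Φ i) = c i) ∧
    (∀ i, c i ≤ e * Cs.ncard) ∧ (∀ i, d (Φ i) = d i) ∧
    (∀ i, c i = 0 → ∀ t ∈ Cr W Cs, rp π i t = 1) ∧
    (∀ i, ζ ^ (c i) * (rp π i g⁻¹).trace = (rp π (Φ i) g⁻¹).trace) ∧
    (∀ s ∈ refls W, fixedSpace (s : (V →ₗ[ℂ] V)ˣ) ∉ Cs → 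
      ∀ i, (rp π i s).trace = (rp π (Φ i) s).trace) := by
  classical
  haveI := hfin.fintype
  let b := Module.finBasis ℂ V
  let D := mkData W b Cs e hC hmap he
  have hact : ∀ (u : V) (w : W) k, eval (fun i => b.repr u i) (D.act w (X k)) = b.repr (toLin W w⁻¹ u) k := by
    intro u w k
    rw [← lin_coord b]
    change eval _ (actw W b w _) = _
    rw [actw_lin, eval_lin]; rfl
  obtain ⟨Φ, c, h1, h2, h3, h4, h5, h6⟩ := core D π hd
  have hα : ∀ (u : V) (H : Cs), u ∉ H.1 → eval (fun i => b.repr u i) (D.α H) ≠ 0 := by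
    intro u H hu h0
    apply hu
    have : D.α H = lin b (formOf W H.1 (hC _ H.2)) := rfl
    rw [this, eval_lin] at h0
    exact (formOf_zero W _ _ u).mp h0
  refine ⟨Φ, c, ?_, h2, ?_, h4, ?_, ?_, ?_⟩
  · intro i
    have h7 := sum_Cr W b Cs e hC hmap he (fun t => 1 - rp π i t) (by simp)
    have h8 : ∑ t ∈ Cr W Cs, (1 - rp π i t) = (c i : ℂ) • 1 := by
      rw [← h1 i, ← h7]; rfl
    rw [Finset.sum_sub_distrib, Finset.sum_const, ← Nat.cast_smul_eq_nsmul ℂ] at h8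
    rw [sub_smul, ← h8]; abel
  · intro i
    have := h3 i
    rw [Set.ncard_eq_toFinset_card', Set.toFinset_card]
    exact this
  · intro i hi t ht
    have hU := h5 i hi
    simp only [Cr, Finset.mem_filter] at ht
    let H : Cs := ⟨_, ht.2.2⟩
    have htS : t ∈ D.St H := by
      simp only [D, mkData, Finset.mem_filter, Finset.mem_univ, true_and]
      exact ((fixed_eq W (hC _ ht.2.2)).mp ⟨ht.2.1, rfl⟩).2
    have hs : ∑ s ∈ D.St H, rp π i s = (D.e : ℂ) • 1 := by
      have := hU H
      rw [U_eq, sub_eq_zero] at this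
      exact this.symm
    have h9 := N_mul_sum D (rp π i) H t htS
    rw [hs, Matrix.mul_smul, mul_one] at h9
    exact smul_right_injective _ (e_ne D H) h9
  · intro i
    apply h6 (fun i => b.repr v i) (fun H => hα v H (hv _ (hC _ H.2)))
    intro k
    rw [hact, inv_inv, hgv]; simp
  · intro s hs hsC i
    obtain ⟨u, hus, hu⟩ : ∃ u ∈ fixedSpace (s : (V →ₗ[ℂ] V)ˣ), ∀ H : Cs, u ∉ H.1 := by
      set F := fixedSpace (s : (V →ₗ[ℂ] V)ˣ) with hF
      let A : Finset (Submodule ℂ F) := Finset.univ.image (fun H : Cs => H.1.comap F.subtype)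
      have hA : (⊤ : Submodule ℂ F) ∉ A := by
        intro hmem
        obtain ⟨H, -, hH⟩ := Finset.mem_image.mp hmem
        have hle : F ≤ H.1 := by
          intro x hx
          have : (⟨x, hx⟩ : F) ∈ H.1.comap F.subtype := by rw [hH]; trivial
          exact this
        have hF' : F ∈ arrangement W := ⟨s, hs, rfl⟩
        have e1 := arr_finrank W hF'
        have e2 := arr_finrank W (hC _ H.2)
        have := Submodule.eq_of_le_of_finrank_le hle (by omega)
        exact hsC (this ▸ H.2)
      have hne := Subspace.biUnion_ne_univ_of_top_notMem hA
      obtain ⟨x, hx⟩ := (Set.ne_univ_iff_exists_notMem _).mp hne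
      refine ⟨x, x.2, fun H hH => hx ?_⟩
      simp only [Set.mem_iUnion]
      exact ⟨_, Finset.mem_image_of_mem _ (Finset.mem_univ H), hH⟩
    have := h6 (fun i => b.repr u i) (fun H => hα u H (hu H)) s 1 (by
      intro k
      rw [hact, one_mul]
      congr 2
      have h7 := (mem_fixedSpace W s u).mp hus
      conv_lhs => rw [← h7]
      exact toLin_inv_apply W s u) i
    simpa using this

end geometry2
end WFF

namespace WFF
open MvPolynomial
open scoped Matrix

section combi
variable {ι K : Type*} [Fintype ι] [Fintype K] (β : ι → ℂ) (c : ι → K → ℕ) (r : K → ℂ)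

theorem combi_A (lg : ℕ)
    (hlg : ∀ L : List K, L.length < lg → ∑ i, β i * (L.map (fun k => r k - c i k)).prod = 0)
    (L : List (K × ℂ)) : ∀ L2 : List K, L.length + L2.length < lg →
    ∑ i, β i * ((L.map (fun p => (c i p.1 : ℂ) - p.2)).prod * (L2.map (fun k => r k - c i k)).prod) = 0 := by
  induction L with
  | nil => intro L2 h; simpa using hlg L2 (by simpa using h)
  | cons p L ih =>
    intro L2 h
    simp only [List.length_cons] at h
    have h1 := ih (p.1 :: L2) (by simp only [List.length_cons]; omega)
    have h2 := ih L2 (by omega)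
    have : ∀ i, β i * (((p :: L).map (fun p => (c i p.1 : ℂ) - p.2)).prod * (L2.map (fun k => r k - c i k)).prod)
      = (r p.1 - p.2) * (β i * ((L.map (fun p => (c i p.1 : ℂ) - p.2)).prod * (L2.map (fun k => r k - c i k)).prod))
       - β i * ((L.map (fun p => (c i p.1 : ℂ) - p.2)).prod * ((p.1 :: L2).map (fun k => r k - c i k)).prod) := by
      intro i
      simp only [List.map_cons, List.prod_cons]
      ring
    rw [Finset.sum_congr rfl (fun i _ => this i), Finset.sum_sub_distrib, ← Finset.mul_sum, h1, h2]
    simp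

theorem combi_B (lg : ℕ)
    (hlg : ∀ L : List K, L.length < lg → ∑ i, β i * (L.map (fun k => r k - c i k)).prod = 0)
    (L : List (K × ℂ × ℂ)) : ∀ P : List (K × ℂ), L.length + P.length ≤ lg →
    ∑ i, β i * ((P.map (fun p => (c i p.1 : ℂ) - p.2)).prod *
      ((L.map (fun p => (c i p.1 : ℂ) - p.2.1)).prod - (L.map (fun p => (c i p.1 : ℂ) - p.2.2)).prod)) = 0 := by
  induction L with
  | nil => intro P h; simp
  | cons p L ih =>
    intro P h
    simp only [List.length_cons] at h
    have h1 := ih ((p.1, p.2.1) :: P) (by simp only [List.length_cons]; omega)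
    have h2 := combi_A β c r lg hlg (P ++ L.map (fun p => (p.1, p.2.2))) [] (by simp; omega)
    have : ∀ i, β i * ((P.map (fun p => (c i p.1 : ℂ) - p.2)).prod *
      (((p :: L).map (fun p => (c i p.1 : ℂ) - p.2.1)).prod - ((p :: L).map (fun p => (c i p.1 : ℂ) - p.2.2)).prod))
      = β i * ((((p.1, p.2.1) :: P).map (fun p => (c i p.1 : ℂ) - p.2)).prod *
      ((L.map (fun p => (c i p.1 : ℂ) - p.2.1)).prod - (L.map (fun p => (c i p.1 : ℂ) - p.2.2)).prod)) +
       (p.2.2 - p.2.1) * (β i * (((P ++ L.map (fun p => (p.1, p.2.2))).map (fun p => (c i p.1 : ℂ) - p.2)).prod * (([] : List K).map (fun k => r k - c i k)).prod)) := by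
      intro i
      simp only [List.map_cons, List.prod_cons, List.map_append, List.prod_append, List.map_map, Function.comp_def,
        List.map_nil, List.prod_nil]
      ring
    rw [Finset.sum_congr rfl (fun i _ => this i), Finset.sum_add_distrib, ← Finset.mul_sum, h1, h2]
    simp

theorem combi_A' (lg : ℕ)
    (hlg : ∀ L : List K, L.length < lg → ∑ i, β i * (L.map (fun k => r k - c i k)).prod = 0)
    {α : Type*} [Fintype α] (σ : α → K) (x : α → ℂ) (h : Fintype.card α < lg) :
    ∑ i, β i * ∏ a, ((c i (σ a) : ℂ) - x a) = 0 := by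
  have := combi_A β c r lg hlg ((Finset.univ : Finset α).toList.map (fun a => (σ a, x a))) []
    (by simpa using h)
  simpa [List.map_map, Function.comp_def] using this

theorem combi_B' (lg : ℕ)
    (hlg : ∀ L : List K, L.length < lg → ∑ i, β i * (L.map (fun k => r k - c i k)).prod = 0)
    {α : Type*} [Fintype α] (σ : α → K) (x y : α → ℂ) (h : Fintype.card α ≤ lg) :
    ∑ i, β i * ∏ a, ((c i (σ a) : ℂ) - x a) = ∑ i, β i * ∏ a, ((c i (σ a) : ℂ) - y a) := by
  have := combi_B β c r lg hlg ((Finset.univ : Finset α).toList.map (fun a => (σ a, x a, y a))) []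
    (by simpa using h)
  rw [← sub_eq_zero, ← Finset.sum_sub_distrib]
  simpa [List.map_map, Function.comp_def, mul_sub] using this

theorem combi_D (dd : ℕ) (ζ : ℂ) (hζ : IsPrimitiveRoot ζ dd) (Φ : K → Equiv.Perm ι)
    (hβ : ∀ k i, β (Φ k i) = ζ ^ (c i k) * β i) (hc : ∀ k i, c (Φ k i) = c i)
    (f : (K → ℕ) → ℂ) (hf : ∀ i, (∀ k, dd ∣ c i k) → f (c i) = 0) : ∑ i, β i * f (c i) = 0 := by
  classical
  have h1 : ∀ (k : K) (h : (K → ℕ) → ℂ), ∑ i, β i * ((1 - ζ ^ (c i k)) * h (c i)) = 0 := by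
    intro k h
    have e := Equiv.sum_comp (Φ k) (fun i => β i * h (c i))
    simp only [hβ, hc] at e
    have : ∀ i, β i * ((1 - ζ ^ (c i k)) * h (c i)) = β i * h (c i) - ζ ^ c i k * β i * h (c i) := by
      intro i; ring
    rw [Finset.sum_congr rfl (fun i _ => this i), Finset.sum_sub_distrib, e, sub_self]
  have h2 : ∀ (k : K) (h : (K → ℕ) → ℂ), (∀ κ, dd ∣ κ k → h κ = 0) → ∑ i, β i * h (c i) = 0 := by
    intro k h hh
    rw [← h1 k (fun κ => h κ / (1 - ζ ^ (κ k)))]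
    apply Finset.sum_congr rfl
    intro i _
    by_cases hi : dd ∣ c i k
    · simp [hh _ hi]
    · have : (1 - ζ ^ (c i k)) ≠ 0 := by
        intro h0
        exact hi ((hζ.pow_eq_one_iff_dvd _).1 (sub_eq_zero.1 h0).symm)
      field_simp
  by_cases hK : Nonempty K
  · have hk0 : ∀ κ : K → ℕ, ∃ k, (¬ (∀ k, dd ∣ κ k)) → ¬ dd ∣ κ k := by
      intro κ
      by_cases h : ∀ k, dd ∣ κ k
      · exact ⟨hK.some, fun h' => absurd h h'⟩
      · push Not at h
        obtain ⟨k, hk⟩ := h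
        exact ⟨k, fun _ => hk⟩
    choose k0 hk0 using hk0
    have : ∀ i, β i * f (c i) = ∑ k, β i * (fun κ => if k0 κ = k ∧ ¬ dd ∣ κ k then f κ else 0) (c i) := by
      intro i
      rw [Finset.sum_eq_single (k0 (c i))]
      · by_cases h : ∀ k, dd ∣ c i k
        · simp [hf i h]
        · simp [hk0 _ h]
      · intro k _ hk
        simp [hk.symm]
      · simp
    rw [Finset.sum_congr rfl (fun i _ => this i), Finset.sum_comm]
    apply Finset.sum_eq_zero
    intro k _
    apply h2 k (fun κ => if k0 κ = k ∧ ¬ dd ∣ κ k then f κ else 0)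
    intro κ hκ
    simp [hκ]
  · apply Finset.sum_eq_zero
    intro i _
    rw [hf i (fun k => absurd ⟨k⟩ hK), mul_zero]

theorem skip_prod (q k : ℕ) (hk : k ≤ q) :
    ∏ j : Fin q, ((k : ℂ) - (if (j : ℕ) < k then ((j : ℕ) : ℂ) else (j : ℕ) + 1)) =
      k.factorial * ((-1) ^ (q - k) * (q - k).factorial) := by
  obtain ⟨n, rfl⟩ := Nat.exists_eq_add_of_le hk
  rw [Fin.prod_univ_eq_prod_range (fun j => (k : ℂ) - (if j < k then (j : ℂ) else j + 1)),
    Finset.prod_range_add]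
  congr 1
  · have : ∀ j ∈ Finset.range k, (k : ℂ) - (if j < k then (j : ℂ) else j + 1) = ((k - 1 - j + 1 : ℕ) : ℂ) := by
      intro j hj
      have hj := Finset.mem_range.1 hj
      rw [if_pos hj, show k - 1 - j + 1 = k - j by omega, Nat.cast_sub hj.le]
    rw [Finset.prod_congr rfl this, ← Finset.prod_range_add_one_eq_factorial]
    push_cast
    have := Finset.prod_range_reflect (fun j => (j : ℂ) + 1) k
    rw [← this]
  · rw [← Finset.prod_range_add_one_eq_factorial, Nat.add_sub_cancel_left]
    push_cast
    rw [← Finset.card_range n, ← Finset.prod_const, Finset.card_range, ← Finset.prod_mul_distrib]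
    apply Finset.prod_congr rfl
    intro j _
    rw [if_neg (by omega)]
    push_cast; ring

theorem combi [DecidableEq K] (M : K → ℕ) (dd : ℕ) (hdd : 0 < dd) (ζ : ℂ) (hζ : IsPrimitiveRoot ζ dd)
    (Φ : K → Equiv.Perm ι)
    (hβ : ∀ k i, β (Φ k i) = ζ ^ (c i k) * β i) (hc : ∀ k i, c (Φ k i) = c i)
    (hle : ∀ i k, c i k ≤ M k) (lg : ℕ)
    (hlg : ∀ L : List K, L.length < lg → ∑ i, β i * (L.map (fun k => r k - c i k)).prod = 0)
    (hdl : dd * lg = ∑ k, M k)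
    (f0 : (K → ℕ) → ℂ) (hf0 : ∀ κ, f0 κ = if κ = 0 then 1 else 0)
    (hb0 : ∑ i, β i * f0 (c i) = 1) :
    ∃ m : K → ℕ, (∀ k, dd * m k = M k) ∧ ∑ k, m k = lg ∧ ∀ f : (K → ℕ) → ℂ,
      ∑ i, β i * f (c i) = ∑ κ ∈ Fintype.piFinset (fun k => Finset.range (m k + 1)),
        (∏ k, ((-1) ^ (κ k) * ((m k).choose (κ k) : ℂ))) * f (fun k => dd * κ k) := by
  classical
  set q : K → ℕ := fun k => M k / dd with hq
  set Box := Fintype.piFinset (fun k => Finset.range (q k + 1)) with hBox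
  let b : (K → ℕ) → ℂ := fun κ => ∑ i, β i * (if c i = (fun k => dd * κ k) then 1 else 0)
  have hinj : ∀ κ κ' : K → ℕ, (fun k => dd * κ k) = (fun k => dd * κ' k) → κ = κ' := by
    intro κ κ' h
    funext k
    exact Nat.eq_of_mul_eq_mul_left hdd (congrFun h k)
  have hI : ∀ f : (K → ℕ) → ℂ, ∑ i, β i * f (c i) = ∑ κ ∈ Box, b κ * f (fun k => dd * κ k) := by
    intro f
    have := combi_D β c dd ζ hζ Φ hβ hc (fun κ' => f κ' - ∑ κ ∈ Box, (if κ' = (fun k => dd * κ k) then 1 else 0) * f (fun k => dd * κ k)) (by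
      intro i hi
      choose κ hκ using hi
      have hκ' : c i = fun k => dd * κ k := funext hκ
      rw [hκ']
      rw [Finset.sum_eq_single κ]
      · simp
      · intro κ' _ hne
        rw [if_neg, zero_mul]
        intro h
        exact hne (hinj _ _ h).symm
      · intro h
        exfalso; apply h
        rw [hBox, Fintype.mem_piFinset]
        intro k
        rw [Finset.mem_range, Nat.lt_succ_iff, hq]
        rw [Nat.le_div_iff_mul_le hdd, mul_comm, ← hκ k]
        exact hle i k)
    simp only [mul_sub, Finset.sum_sub_distrib, sub_eq_zero] at this
    rw [this]
    simp only [Finset.mul_sum, b, Finset.sum_mul]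
    rw [Finset.sum_comm]
    simp only [mul_assoc]
  have hbz : b 0 = 1 := by
    rw [← hb0]
    apply Finset.sum_congr rfl
    intro i _
    rw [hf0]
    congr 1
  let x : (K → ℕ) → (Σ k, Fin (q k)) → ℂ := fun κ a => dd * (if (a.2 : ℕ) < κ a.1 then ((a.2 : ℕ) : ℂ) else (a.2 : ℕ) + 1)
  have hsingle : ∀ κ ∈ Box, ∑ i, β i * ∏ a : (Σ k, Fin (q k)), ((c i a.1 : ℂ) - x κ a) =
      b κ * ∏ k, ((dd : ℂ) ^ (q k) * ((κ k).factorial * ((-1) ^ (q k - κ k) * (q k - κ k).factorial))) := by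
    intro κ hκ
    rw [hI (fun γ => ∏ a : (Σ k, Fin (q k)), ((γ a.1 : ℂ) - x κ a))]
    rw [Finset.sum_eq_single κ]
    · congr 1
      rw [Fintype.prod_sigma]
      apply Finset.prod_congr rfl
      intro k _
      have hk : κ k ≤ q k := by
        have := Fintype.mem_piFinset.1 hκ k
        rw [Finset.mem_range] at this; omega
      rw [← skip_prod _ _ hk]
      have hp : (dd : ℂ) ^ (q k) = ∏ _j : Fin (q k), (dd : ℂ) := by simp
      rw [hp, ← Finset.prod_mul_distrib]
      apply Finset.prod_congr rfl
      intro j _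
      simp only [x]
      push_cast
      ring
    · intro κ' hκ' hne
      obtain ⟨k, hk⟩ : ∃ k, κ' k ≠ κ k := by
        by_contra h; push Not at h; exact hne (funext h)
      have hb' : κ' k ≤ q k := by
        have := Fintype.mem_piFinset.1 hκ' k
        rw [Finset.mem_range] at this; omega
      have hb : κ k ≤ q k := by
        have := Fintype.mem_piFinset.1 hκ k
        rw [Finset.mem_range] at this; omega
      rw [mul_eq_zero]; right
      rcases lt_or_gt_of_ne hk with h | h
      · apply Finset.prod_eq_zero (Finset.mem_univ (⟨k, ⟨κ' k, by omega⟩⟩ : Σ k, Fin (q k)))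
        simp [x, h]
      · apply Finset.prod_eq_zero (Finset.mem_univ (⟨k, ⟨κ' k - 1, by omega⟩⟩ : Σ k, Fin (q k)))
        simp only [x]
        rw [if_neg (by omega), Nat.cast_sub (by omega)]
        push_cast; ring
    · intro h; exact absurd hκ h
  have h0Box : (0 : K → ℕ) ∈ Box := by
    rw [hBox, Fintype.mem_piFinset]; intro k; simp
  have hcard : Fintype.card (Σ k, Fin (q k)) = ∑ k, q k := by simp
  have hddC : (dd : ℂ) ≠ 0 := by exact_mod_cast hdd.ne'
  have hge : lg ≤ ∑ k, q k := by
    by_contra hlt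
    push Not at hlt
    have h1 := hsingle 0 h0Box
    rw [combi_A' β c r lg hlg (fun a : (Σ k, Fin (q k)) => a.1) (x 0) (by rw [hcard]; exact hlt), hbz, one_mul] at h1
    refine Finset.prod_ne_zero_iff.2 ?_ h1.symm
    intro k _
    have := Nat.factorial_ne_zero (q k)
    simp [hddC, this]
  have hqM : ∀ k, dd * q k ≤ M k := fun k => Nat.mul_div_le _ _
  have hsum : ∑ k, dd * q k = ∑ k, M k := by
    apply le_antisymm (Finset.sum_le_sum (fun k _ => hqM k))
    rw [← hdl, ← Finset.mul_sum]
    exact Nat.mul_le_mul_left _ hge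
  have hqM' : ∀ k, dd * q k = M k := by
    intro k
    exact (Finset.sum_eq_sum_iff_of_le (fun k _ => hqM k)).1 hsum k (Finset.mem_univ k)
  have hsumq : ∑ k, q k = lg := by
    apply Nat.eq_of_mul_eq_mul_left hdd
    rw [hdl, ← hsum, Finset.mul_sum]
  refine ⟨q, hqM', hsumq, ?_⟩
  intro f
  rw [hI f]
  apply Finset.sum_congr rfl
  intro κ hκ
  congr 1
  have h1 := hsingle κ hκ
  rw [combi_B' β c r lg hlg (fun a : (Σ k, Fin (q k)) => a.1) (x κ) (x 0) (by rw [hcard, hsumq]), hsingle 0 h0Box, hbz, one_mul] at h1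
  have hne : (∏ k, ((dd : ℂ) ^ (q k) * ((κ k).factorial * ((-1) ^ (q k - κ k) * (q k - κ k).factorial)))) ≠ 0 := by
    refine Finset.prod_ne_zero_iff.2 ?_
    intro k _
    have h1 := Nat.factorial_ne_zero (κ k)
    have h2 := Nat.factorial_ne_zero (q k - κ k)
    simp [hddC, h1, h2]
  apply mul_right_cancel₀ hne
  rw [← h1, ← Finset.prod_mul_distrib]
  apply Finset.prod_congr rfl
  intro k _
  have hk : κ k ≤ q k := by
    have := Fintype.mem_piFinset.1 hκ k
    rw [Finset.mem_range] at this; omega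
  have e := Nat.choose_mul_factorial_mul_factorial hk
  have e' : ((q k).factorial : ℂ) = (q k).choose (κ k) * (κ k).factorial * (q k - κ k).factorial := by
    exact_mod_cast e.symm
  have e2 : (-1 : ℂ) ^ (q k) = (-1) ^ (κ k) * (-1) ^ (q k - κ k) := by
    rw [← pow_add]; congr 1; omega
  simp only [Pi.zero_apply, Nat.factorial_zero, Nat.sub_zero, Nat.cast_one]
  rw [e', e2]
  ring

end combi
end WFF

namespace WFF
open MvPolynomial
open scoped Matrix

section regtr
variable {G : Type*} [Group G] [Fintype G] [DecidableEq G] {ι : Type*} [Fintype ι] [DecidableEq ι] {d : ι → ℕ}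
  (π : MonoidAlgebra ℂ G ≃ₐ[ℂ] ∀ i, Matrix (Fin (d i)) (Fin (d i)) ℂ)

theorem reg_trace1 (x : MonoidAlgebra ℂ G) :
    LinearMap.trace ℂ (MonoidAlgebra ℂ G) (LinearMap.mulLeft ℂ x) = ∑ i, (d i : ℂ) * (π x i).trace := by
  let B := (Pi.basis (fun i => Matrix.stdBasis ℂ (Fin (d i)) (Fin (d i)))).map π.symm.toLinearEquiv
  rw [LinearMap.trace_eq_matrix_trace ℂ B, Matrix.trace]
  rw [Fintype.sum_sigma]
  apply Finset.sum_congr rfl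
  intro i _
  rw [Fintype.sum_prod_type, Matrix.trace, Finset.mul_sum]
  apply Finset.sum_congr rfl
  intro a _
  have : ∀ b, (LinearMap.toMatrix B B (LinearMap.mulLeft ℂ x)).diag ⟨i, (a, b)⟩ = π x i a a := by
    intro b
    rw [Matrix.diag_apply, LinearMap.toMatrix_apply, LinearMap.mulLeft_apply]
    simp only [B, Module.Basis.map_repr, Module.Basis.map_apply, LinearEquiv.trans_apply, Pi.basis_repr, Pi.basis_apply,
      Matrix.stdBasis_eq_single]
    have h : (π.symm.toLinearEquiv.symm (x * π.symm.toLinearEquiv (Pi.single i (Matrix.single a b 1)))) i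
       = π x i * Matrix.single a b 1 := by
      have : (π (x * π.symm (Pi.single i (Matrix.single a b 1)))) i = π x i * Matrix.single a b 1 := by
        rw [map_mul, AlgEquiv.apply_symm_apply]; simp
      exact this
    rw [h]
    have h2 : ∀ M : Matrix (Fin (d i)) (Fin (d i)) ℂ, (Matrix.stdBasis ℂ (Fin (d i)) (Fin (d i))).repr M (a, b) = M a b := by
      intro M
      simp [Matrix.stdBasis, Pi.basis_repr]
    rw [h2]
    simp
  rw [Finset.sum_congr rfl (fun v _ => this v)]
  simp

theorem reg_trace2 (w : G) :
    LinearMap.trace ℂ (MonoidAlgebra ℂ G) (LinearMap.mulLeft ℂ (MonoidAlgebra.of ℂ G w)) = if w = 1 then (Fintype.card G : ℂ) else 0 := by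
  rw [LinearMap.trace_eq_matrix_trace ℂ (MonoidAlgebra.basis G ℂ), Matrix.trace]
  have : ∀ v, (LinearMap.toMatrix (MonoidAlgebra.basis G ℂ) (MonoidAlgebra.basis G ℂ) (LinearMap.mulLeft ℂ (MonoidAlgebra.of ℂ G w))).diag v = if w = 1 then 1 else 0 := by
    intro v
    rw [Matrix.diag_apply, LinearMap.toMatrix_apply, LinearMap.mulLeft_apply]
    rw [MonoidAlgebra.basis_apply, MonoidAlgebra.of_apply, MonoidAlgebra.single_mul_single]
    change (MonoidAlgebra.single (w * v) (1 * 1 : ℂ)).coeff v = _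
    rw [MonoidAlgebra.coeff_single, Finsupp.single_apply]
    simp
  rw [Finset.sum_congr rfl (fun v _ => this v)]
  simp

theorem reg_trace (w : G) : ∑ i, (d i : ℂ) * (rp π i w).trace = if w = 1 then (Fintype.card G : ℂ) else 0 := by
  rw [← reg_trace2, reg_trace1 π]; rfl

/-- Frobenius type formula for factorizations of `g`. -/
theorem frob {K : Type*} (g : G) (R : K → Finset G) (z : ι → K → ℂ)
    (hz : ∀ i k, ∑ t ∈ R k, rp π i t = z i k • 1) {N : ℕ} (τ : Fin N → K) :
    (Fintype.card G : ℂ) * ((Fintype.piFinset (fun j => R (τ j))).filter (fun t => (List.ofFn t).prod = g)).card =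
      ∑ i, (d i : ℂ) * (rp π i g⁻¹).trace * ∏ j, z i (τ j) := by
  have h1 : ∀ i, ∑ t ∈ Fintype.piFinset (fun j => R (τ j)), rp π i ((List.ofFn t).prod) = (∏ j, z i (τ j)) • 1 := by
    intro i
    have h := MultilinearMap.map_sum_finset (MultilinearMap.mkPiAlgebraFin ℂ N (Matrix (Fin (d i)) (Fin (d i)) ℂ))
      (fun _ t => rp π i t) (fun j => R (τ j))
    simp only [MultilinearMap.mkPiAlgebraFin_apply] at h
    have h' : ∀ t : Fin N → G, rp π i ((List.ofFn t).prod) = (List.ofFn fun j => rp π i (t j)).prod := by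
      intro t
      rw [map_list_prod, List.map_ofFn]; rfl
    rw [Finset.sum_congr rfl (fun t _ => h' t), ← h]
    simp only [hz]
    have h3 := (MultilinearMap.mkPiAlgebraFin ℂ N (Matrix (Fin (d i)) (Fin (d i)) ℂ)).map_smul_univ (fun j => z i (τ j)) (fun _ => 1)
    simp only [MultilinearMap.mkPiAlgebraFin_apply] at h3
    rw [h3]
    simp
  rw [Finset.card_filter]
  push_cast
  rw [Finset.mul_sum]
  have h2 : ∀ t : Fin N → G, (Fintype.card G : ℂ) * (if (List.ofFn t).prod = g then 1 else 0) =
      ∑ i, (d i : ℂ) * (rp π i ((List.ofFn t).prod) * rp π i g⁻¹).trace := by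
    intro t
    simp only [← map_mul]
    rw [reg_trace π, mul_ite, mul_one, mul_zero]
    simp only [mul_inv_eq_one]
  rw [Finset.sum_congr rfl (fun t _ => h2 t), Finset.sum_comm]
  apply Finset.sum_congr rfl
  intro i _
  rw [← Finset.mul_sum, ← Matrix.trace_sum, ← Finset.sum_mul, h1, smul_mul_assoc, one_mul, Matrix.trace_smul, smul_eq_mul]
  ring

theorem triv_index (hd : ∀ i, 0 < d i) :
    ∃ i0, (∀ i, (∀ w, rp π i w = 1) ↔ i = i0) ∧ d i0 = 1 := by
  have hsc : ∀ x : MonoidAlgebra ℂ G, ∃ c : ℂ, ∀ i, (∀ w, rp π i w = 1) → π x i = c • 1 := by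
    intro x
    induction x using MonoidAlgebra.induction_on with
    | of w => exact ⟨1, fun i hi => by rw [one_smul]; exact hi w⟩
    | add x y hx hy =>
      obtain ⟨a, ha⟩ := hx
      obtain ⟨b, hb⟩ := hy
      exact ⟨a + b, fun i hi => by rw [map_add, Pi.add_apply, ha i hi, hb i hi, add_smul]⟩
    | smul r x hx =>
      obtain ⟨a, ha⟩ := hx
      exact ⟨r * a, fun i hi => by rw [map_smul, Pi.smul_apply, ha i hi, mul_smul]⟩
  obtain ⟨i0, hi0⟩ : ∃ i, ∀ w, rp π i w = 1 := by
    let s : MonoidAlgebra ℂ G := ∑ w, MonoidAlgebra.of ℂ G w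
    have hl : ∀ w, MonoidAlgebra.of ℂ G w * s = s := by
      intro w
      simp only [s, Finset.mul_sum, ← map_mul]
      exact Equiv.sum_comp (Equiv.mulLeft w) (fun v => MonoidAlgebra.of ℂ G v)
    have hr : ∀ w, s * MonoidAlgebra.of ℂ G w = s := by
      intro w
      simp only [s, Finset.sum_mul, ← map_mul]
      exact Equiv.sum_comp (Equiv.mulRight w) (fun v => MonoidAlgebra.of ℂ G v)
    have hs : s ≠ 0 := by
      intro h
      have := congrArg (fun x : MonoidAlgebra ℂ G => x.coeff 1) h
      simp [s, MonoidAlgebra.of_apply, MonoidAlgebra.coeff_sum, Finsupp.single_apply] at this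
    have hπ : π s ≠ 0 := by
      intro h
      exact hs (π.injective (by rw [h, map_zero]))
    obtain ⟨i, hi⟩ := Function.ne_iff.1 hπ
    refine ⟨i, fun w => ?_⟩
    have hl' : ∀ w, rp π i w * π s i = π s i := fun w => by
      change π (MonoidAlgebra.of ℂ G w) i * π s i = _
      rw [← Pi.mul_apply, ← map_mul, hl]
    have hr' : ∀ w, π s i * rp π i w = π s i := fun w => by
      change π s i * π (MonoidAlgebra.of ℂ G w) i = _
      rw [← Pi.mul_apply, ← map_mul, hr]
    obtain ⟨c, hc⟩ := scalar_of_commute π i (π s i) (fun w => by rw [hl', hr'])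
    have hc0 : c ≠ 0 := by
      rintro rfl
      exact hi (by rw [hc, zero_smul]; rfl)
    have := hl' w
    rw [hc, mul_smul_comm, mul_one] at this
    exact smul_right_injective _ hc0 this
  refine ⟨i0, fun i => ⟨fun hi => ?_, fun h => h ▸ hi0⟩, ?_⟩
  · by_contra hne
    obtain ⟨c, hc⟩ := hsc (π.symm (Pi.single i 1))
    have h1 := hc i hi
    have h2 := hc i0 hi0
    rw [AlgEquiv.apply_symm_apply] at h1 h2
    rw [Pi.single_eq_same] at h1
    rw [Pi.single_eq_of_ne (Ne.symm hne)] at h2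
    have h1' := congrFun (congrFun h1 ⟨0, hd i⟩) ⟨0, hd i⟩
    have h2' := congrFun (congrFun h2 ⟨0, hd i0⟩) ⟨0, hd i0⟩
    simp at h1' h2'
    rw [← h2'] at h1'
    exact one_ne_zero h1'
  · by_contra hne
    have h2 : 1 < d i0 := by have := hd i0; omega
    obtain ⟨c, hc⟩ := hsc (π.symm (Pi.single i0 (Matrix.single ⟨0, hd i0⟩ ⟨0, hd i0⟩ 1)))
    have h1 := hc i0 hi0
    rw [AlgEquiv.apply_symm_apply, Pi.single_eq_same] at h1
    have h1' := congrFun (congrFun h1 ⟨0, hd i0⟩) ⟨0, hd i0⟩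
    have h2' := congrFun (congrFun h1 ⟨1, h2⟩) ⟨1, h2⟩
    simp [Matrix.single_apply] at h1' h2'
    rw [← h2'] at h1'
    exact one_ne_zero h1'

end regtr
end WFF

namespace WFF
open MvPolynomial
open scoped Matrix

section grp
variable {G : Type*} [Group G] [Fintype G] [DecidableEq G] {ι : Type*} [Fintype ι] [DecidableEq ι] {d : ι → ℕ}
  (π : MonoidAlgebra ℂ G ≃ₐ[ℂ] ∀ i, Matrix (Fin (d i)) (Fin (d i)) ℂ) {K : Type*} [Fintype K] [DecidableEq K]

theorem grp_count (hd : ∀ i, 0 < d i) (g : G) (R : K → Finset G) (M : K → ℕ) (dd : ℕ) (hdd : 0 < dd) (ζ : ℂ)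
    (hζ : IsPrimitiveRoot ζ dd) (lg : ℕ) (hdl : dd * lg = ∑ k, M k)
    (hlen : ∀ N < lg, ∀ t : Fin N → G, (∀ j, ∃ k, t j ∈ R k) → (List.ofFn t).prod ≠ g)
    (hgen : Subgroup.closure {t | ∃ k, t ∈ R k} = ⊤)
    (hgeo : ∀ k, ∃ (Φ : Equiv.Perm ι) (c : ι → ℕ),
      (∀ i, ∑ t ∈ R k, rp π i t = (((R k).card : ℂ) - c i) • 1) ∧ (∀ i, c (Φ i) = c i) ∧
      (∀ i, c i ≤ M k) ∧ (∀ i, d (Φ i) = d i) ∧ (∀ i, c i = 0 → ∀ t ∈ R k, rp π i t = 1) ∧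
      (∀ i, ζ ^ (c i) * (rp π i g⁻¹).trace = (rp π (Φ i) g⁻¹).trace) ∧
      (∀ k', k' ≠ k → ∀ s ∈ R k', ∀ i, (rp π i s).trace = (rp π (Φ i) s).trace)) :
    ∃ m : K → ℕ, (∀ k, dd * m k = M k) ∧ ∑ k, m k = lg ∧ ∀ (N : ℕ) (τ : Fin N → K),
      (Fintype.card G : ℤ) * ((Fintype.piFinset (fun j => R (τ j))).filter (fun t => (List.ofFn t).prod = g)).card =
      ∏ k, ∑ p ∈ Finset.range (m k + 1), (-1) ^ p * ((m k).choose p : ℤ) *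
        (((R k).card : ℤ) - p * dd) ^ (Finset.univ.filter (fun j => τ j = k)).card := by
  choose Φ c' h1 h2 h3 h4 h5 h6 h7 using hgeo
  let c : ι → K → ℕ := fun i k => c' k i
  let β : ι → ℂ := fun i => (d i : ℂ) * (rp π i g⁻¹).trace
  have hz : ∀ i k, ∑ t ∈ R k, rp π i t = (((R k).card : ℂ) - c i k) • 1 := fun i k => h1 k i
  have htr : ∀ i k, ∑ t ∈ R k, (rp π i t).trace = (((R k).card : ℂ) - c i k) * d i := by
    intro i k
    rw [← Matrix.trace_sum, hz, Matrix.trace_smul, Matrix.trace_one, Fintype.card_fin, smul_eq_mul]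
  have hdC : ∀ i, (d i : ℂ) ≠ 0 := fun i => by exact_mod_cast (hd i).ne'
  have hc : ∀ k i, c (Φ k i) = c i := by
    intro k i
    funext k'
    by_cases hk : k' = k
    · subst hk; exact h2 k' i
    · have e1 := htr i k'
      have e2 := htr (Φ k i) k'
      rw [← Finset.sum_congr rfl (fun s hs => h7 k k' hk s hs i), e1, h4] at e2
      have e3 := mul_right_cancel₀ (hdC i) e2
      have e4 : (c i k' : ℂ) = c (Φ k i) k' := by linear_combination -e3
      exact_mod_cast e4.symm
  have hβ : ∀ k i, β (Φ k i) = ζ ^ (c i k) * β i := by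
    intro k i
    simp only [β, h4, ← h6]
    ring
  have hlg : ∀ L : List K, L.length < lg →
      ∑ i, β i * (L.map (fun k => ((R k).card : ℂ) - c i k)).prod = 0 := by
    intro L hL
    have hf := frob π g R (fun i k => ((R k).card : ℂ) - c i k) hz L.get
    rw [Finset.filter_false_of_mem, Finset.card_empty, Nat.cast_zero, mul_zero] at hf
    · rw [hf]
      apply Finset.sum_congr rfl
      intro i _
      congr 1
      rw [← List.prod_ofFn]
      congr 1
      conv_lhs => rw [← List.ofFn_get L]
      rw [List.map_ofFn]; rfl
    · intro t ht
      apply hlen _ hL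
      intro j
      exact ⟨_, Fintype.mem_piFinset.1 ht j⟩
  have hb0 : ∑ i, β i * (fun κ : K → ℕ => if κ = 0 then (1 : ℂ) else 0) (c i) = 1 := by
    obtain ⟨i0, hi0, hd0⟩ := triv_index π hd
    have hiff : ∀ i, c i = 0 ↔ i = i0 := by
      intro i
      rw [← hi0 i]
      constructor
      · intro h w
        have : ∀ w ∈ Subgroup.closure {t | ∃ k, t ∈ R k}, w ∈ (rp π i).ker := by
          have : Subgroup.closure {t | ∃ k, t ∈ R k} ≤ (rp π i).ker := by
            rw [Subgroup.closure_le]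
            rintro t ⟨k, hk⟩
            exact h5 k i (congrFun h k) t hk
          exact this
        exact this w (by rw [hgen]; trivial)
      · intro h
        funext k
        have e := hz i k
        simp only [h, Finset.sum_const] at e
        have e' := congrFun (congrFun e ⟨0, hd i⟩) ⟨0, hd i⟩
        simp only [Matrix.smul_apply, Matrix.one_apply_eq, nsmul_eq_mul, smul_eq_mul, mul_one] at e'
        have e2 : (c i k : ℂ) = 0 := by linear_combination e'
        exact_mod_cast e2
    rw [Finset.sum_eq_single i0]
    · have h0 := (hi0 i0).2 rfl
      simp only [(hiff i0).2 rfl, β, h0, Matrix.trace_one, hd0]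
      simp [hd0]
    · intro i _ hne
      simp [mt (hiff i).1 hne]
    · simp
  obtain ⟨m, hm1, hm2, hm3⟩ := combi β c (fun k => ((R k).card : ℂ)) M dd hdd ζ hζ Φ hβ hc (fun i k => h3 k i) lg hlg hdl
    (fun κ => if κ = 0 then 1 else 0) (fun _ => rfl) hb0
  refine ⟨m, hm1, hm2, ?_⟩
  intro N τ
  have hf := frob π g R (fun i k => ((R k).card : ℂ) - c i k) hz τ
  have hpr : ∀ i, ∏ j, (((R (τ j)).card : ℂ) - c i (τ j)) =
      ∏ k, (((R k).card : ℂ) - c i k) ^ (Finset.univ.filter (fun j => τ j = k)).card := by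
    intro i
    rw [← Finset.prod_fiberwise' Finset.univ τ (fun k => (((R k).card : ℂ) - c i k))]
    simp
  simp only [hpr] at hf
  have := hm3 (fun κ => ∏ k, (((R k).card : ℂ) - κ k) ^ (Finset.univ.filter (fun j => τ j = k)).card)
  simp only [β] at this
  rw [this] at hf
  simp only [← Finset.prod_mul_distrib] at hf
  rw [← Finset.prod_univ_sum (fun k => Finset.range (m k + 1)) (fun k p => (-1 : ℂ) ^ p * ((m k).choose p : ℂ) *
        (((R k).card : ℂ) - (dd * p : ℕ)) ^ (Finset.univ.filter (fun j => τ j = k)).card)] at hf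
  have hf2 := hf
  apply Int.cast_injective (α := ℂ)
  push_cast at hf2 ⊢
  rw [hf2]
  simp only [mul_comm (dd : ℂ)]

theorem factor_zero (m l : ℕ) (hl : l < m) (a e : ℤ) :
    ∑ p ∈ Finset.range (m + 1), (-1) ^ p * (m.choose p : ℤ) * (a - p * e) ^ l = 0 := by
  have hdeg : ((Polynomial.C a - Polynomial.X * Polynomial.C e) ^ l : Polynomial ℤ).natDegree < m := by
    refine lt_of_le_of_lt ?_ hl
    refine Polynomial.natDegree_pow_le.trans ?_
    have h1 : (Polynomial.C a - Polynomial.X * Polynomial.C e : Polynomial ℤ).natDegree ≤ 1 := by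
      compute_degree
    nlinarith
  have h := congrFun (Polynomial.fwdDiff_iter_eq_zero_of_degree_lt hdeg) 0
  rw [fwdDiff_iter_eq_sum_shift] at h
  have h2 : ∑ p ∈ Finset.range (m + 1), (-1) ^ p * (m.choose p : ℤ) * (a - p * e) ^ l =
      (-1) ^ m * ∑ k ∈ Finset.range (m + 1), ((-1) ^ (m - k) * (m.choose k : ℤ)) •
        ((Polynomial.C a - Polynomial.X * Polynomial.C e) ^ l : Polynomial ℤ).eval (0 + k • 1) := by
    rw [Finset.mul_sum]
    apply Finset.sum_congr rfl
    intro k hk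
    have hk := Finset.mem_range.1 hk
    have e2 : (-1 : ℤ) ^ m = (-1) ^ (m - k) * (-1) ^ k := by rw [← pow_add]; congr 1; omega
    have e3 : (-1 : ℤ) ^ (m - k) * (-1) ^ (m - k) = 1 := by rw [← mul_pow]; simp
    simp only [Polynomial.eval_pow, Polynomial.eval_sub, Polynomial.eval_mul, Polynomial.eval_C, Polynomial.eval_X,
      zero_add, nsmul_eq_mul, mul_one, smul_eq_mul]
    rw [e2]
    linear_combination (-(-1) ^ k * (m.choose k : ℤ) * (a - k * e) ^ l) * e3
  rw [h2, h]
  simp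

end grp

/-- number of functions with prescribed fibre sizes -/
theorem count_types {K : Type*} [Fintype K] [DecidableEq K] (N : ℕ) (l : K → ℕ) (hN : N = ∑ k, l k) :
    (∏ k, (l k).factorial) * (Finset.univ.filter (fun τ : Fin N → K => ∀ k,
      (Finset.univ.filter (fun j => τ j = k)).card = l k)).card = N.factorial := by
  have hmon : ∀ f : K → ℕ, (∏ k, (X k : MvPolynomial K ℕ) ^ f k) = monomial (Finsupp.equivFunOnFinite.symm f) 1 := by
    intro f
    rw [monomial_eq, Finsupp.prod_fintype _ _ (by simp)]
    simp
  have h1 : (∑ k, (X k : MvPolynomial K ℕ)) ^ N = ∑ τ : Fin N → K,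
      monomial (Finsupp.equivFunOnFinite.symm (fun k => (Finset.univ.filter (fun j => τ j = k)).card)) 1 := by
    have e : (∑ k, (X k : MvPolynomial K ℕ)) ^ N = ∏ _j : Fin N, ∑ k, (X k : MvPolynomial K ℕ) := by simp
    rw [e, Finset.prod_univ_sum, Fintype.piFinset_univ]
    apply Finset.sum_congr rfl
    intro τ _
    rw [← hmon, ← Finset.prod_fiberwise' Finset.univ τ (fun k => (X k : MvPolynomial K ℕ))]
    simp
  rw [Finset.sum_pow_eq_sum_piAntidiag] at h1
  have h2 := congrArg (coeff (Finsupp.equivFunOnFinite.symm l)) h1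
  simp only [hmon, coeff_sum, coeff_monomial, Equiv.apply_eq_iff_eq] at h2
  rw [Finset.sum_eq_single l] at h2
  · have h3 : coeff (Finsupp.equivFunOnFinite.symm l) ((Nat.multinomial Finset.univ l : MvPolynomial K ℕ) *
      monomial (Finsupp.equivFunOnFinite.symm l) 1) = Nat.multinomial Finset.univ l := by
      rw [← map_natCast (C : ℕ →+* MvPolynomial K ℕ), coeff_C_mul, coeff_monomial, if_pos rfl]; simp
    rw [h3, ← Finset.card_filter] at h2
    have h4 := Nat.multinomial_spec Finset.univ l
    rw [h2, ← hN] at h4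
    rw [← h4]
    congr 2
    ext τ
    simp only [Finset.mem_filter, Finset.mem_univ, true_and, funext_iff]
  · intro l' _ hne
    rw [← map_natCast (C : ℕ →+* MvPolynomial K ℕ), coeff_C_mul, coeff_monomial, if_neg, mul_zero]
    simpa using hne
  · intro h
    exfalso; apply h
    simp [Finset.mem_piAntidiag, hN]

section absfin
variable {G : Type*} [Group G] [Fintype G] [DecidableEq G] {K : Type*} [Fintype K] [DecidableEq K]

theorem fib_eq (R : K → Finset G) (hR : ∀ t k k', t ∈ R k → t ∈ R k' → k = k') {N : ℕ} {τ : Fin N → K} {t : Fin N → G}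
    (ht : t ∈ Fintype.piFinset (fun j => R (τ j))) (k : K) :
    Finset.univ.filter (fun j => t j ∈ R k) = Finset.univ.filter (fun j => τ j = k) := by
  ext j
  simp only [Finset.mem_filter, Finset.mem_univ, true_and]
  have hj := Fintype.mem_piFinset.1 ht j
  constructor
  · intro h; exact hR _ _ _ hj h
  · rintro rfl; exact hj

theorem abs_b (g : G) (R : K → Finset G) (hR : ∀ t k k', t ∈ R k → t ∈ R k' → k = k') (m : K → ℕ) (dd : ℕ)
    (h : ∀ (N : ℕ) (τ : Fin N → K),
      (Fintype.card G : ℤ) * ((Fintype.piFinset (fun j => R (τ j))).filter (fun t => (List.ofFn t).prod = g)).card =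
      ∏ k, ∑ p ∈ Finset.range (m k + 1), (-1) ^ p * ((m k).choose p : ℤ) *
        (((R k).card : ℤ) - p * dd) ^ (Finset.univ.filter (fun j => τ j = k)).card)
    {N : ℕ} (t : Fin N → G) (ht : ∀ j, ∃ k, t j ∈ R k) (hp : (List.ofFn t).prod = g) (k : K) :
    m k ≤ (Finset.univ.filter (fun j => t j ∈ R k)).card := by
  choose τ hτ using ht
  have hmem : t ∈ Fintype.piFinset (fun j => R (τ j)) := Fintype.mem_piFinset.2 hτ
  rw [fib_eq R hR hmem]
  by_contra hlt
  push Not at hlt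
  have h1 := h N τ
  rw [Finset.prod_eq_zero (Finset.mem_univ k) (factor_zero _ _ hlt _ _)] at h1
  have h2 : (Fintype.card G : ℤ) ≠ 0 := by exact_mod_cast Fintype.card_ne_zero
  have h3 : ((Fintype.piFinset (fun j => R (τ j))).filter (fun t => (List.ofFn t).prod = g)).card ≠ 0 :=
    Finset.card_ne_zero_of_mem (Finset.mem_filter.2 ⟨hmem, hp⟩)
  rcases mul_eq_zero.1 h1 with h4 | h4
  · exact h2 h4
  · exact h3 (by exact_mod_cast h4)

theorem abs_a (g : G) (R : K → Finset G) (hR : ∀ t k k', t ∈ R k → t ∈ R k' → k = k') (m : K → ℕ) (dd : ℕ)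
    (h : ∀ (N : ℕ) (τ : Fin N → K),
      (Fintype.card G : ℤ) * ((Fintype.piFinset (fun j => R (τ j))).filter (fun t => (List.ofFn t).prod = g)).card =
      ∏ k, ∑ p ∈ Finset.range (m k + 1), (-1) ^ p * ((m k).choose p : ℤ) *
        (((R k).card : ℤ) - p * dd) ^ (Finset.univ.filter (fun j => τ j = k)).card)
    {N : ℕ} (l : K → ℕ) (hN : N = ∑ k, l k) (S : Finset (Fin N → G))
    (hS : ∀ t, t ∈ S ↔ ((∀ j, ∃ k, t j ∈ R k) ∧ (List.ofFn t).prod = g) ∧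
      ∀ k, (Finset.univ.filter (fun j => t j ∈ R k)).card = l k) :
    (Fintype.card G : ℤ) * (∏ k, ((l k).factorial : ℤ)) * S.card =
      (N.factorial : ℤ) * ∏ k, ∑ p ∈ Finset.range (m k + 1), (-1) ^ p * ((m k).choose p : ℤ) *
        (((R k).card : ℤ) - p * dd) ^ (l k) := by
  set T := Finset.univ.filter (fun τ : Fin N → K => ∀ k, (Finset.univ.filter (fun j => τ j = k)).card = l k) with hT
  have hSeq : S = T.biUnion (fun τ => (Fintype.piFinset (fun j => R (τ j))).filter (fun t => (List.ofFn t).prod = g)) := by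
    ext t
    rw [hS, Finset.mem_biUnion]
    constructor
    · rintro ⟨⟨h1, h2⟩, h3⟩
      choose τ hτ using h1
      have hmem : t ∈ Fintype.piFinset (fun j => R (τ j)) := Fintype.mem_piFinset.2 hτ
      refine ⟨τ, ?_, Finset.mem_filter.2 ⟨hmem, h2⟩⟩
      rw [hT, Finset.mem_filter]
      refine ⟨Finset.mem_univ _, fun k => ?_⟩
      rw [← fib_eq R hR hmem, h3]
    · rintro ⟨τ, hτ, ht⟩
      obtain ⟨hmem, hp⟩ := Finset.mem_filter.1 ht
      refine ⟨⟨fun j => ⟨_, Fintype.mem_piFinset.1 hmem j⟩, hp⟩, fun k => ?_⟩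
      rw [fib_eq R hR hmem]
      exact (Finset.mem_filter.1 hτ).2 k
  have hcard : S.card = ∑ τ ∈ T, ((Fintype.piFinset (fun j => R (τ j))).filter (fun t => (List.ofFn t).prod = g)).card := by
    rw [hSeq]
    apply Finset.card_biUnion
    intro τ _ τ' _ hne
    rw [Function.onFun, Finset.disjoint_left]
    intro t ht ht'
    apply hne
    funext j
    exact hR _ _ _ (Fintype.mem_piFinset.1 (Finset.mem_filter.1 ht).1 j) (Fintype.mem_piFinset.1 (Finset.mem_filter.1 ht').1 j)
  have hcount := count_types N l hN
  have h1 : (Fintype.card G : ℤ) * S.card = T.card * ∏ k, ∑ p ∈ Finset.range (m k + 1), (-1) ^ p * ((m k).choose p : ℤ) *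
        (((R k).card : ℤ) - p * dd) ^ (l k) := by
    rw [hcard, Nat.cast_sum, Finset.mul_sum, ← nsmul_eq_mul, ← Finset.sum_const]
    apply Finset.sum_congr rfl
    intro τ hτ
    rw [h N τ]
    simp only [(Finset.mem_filter.1 hτ).2]
  have h2 : (N.factorial : ℤ) = (∏ k, ((l k).factorial : ℤ)) * T.card := by exact_mod_cast hcount.symm
  rw [h2]
  linear_combination (∏ k, ((l k).factorial : ℤ)) * h1

end absfin
end WFF

namespace WFF
open MvPolynomial
open scoped Matrix

theorem arr_map {V : Type*} [AddCommGroup V] [Module ℂ V] [FiniteDimensional ℂ V]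
    (W : Subgroup (V →ₗ[ℂ] V)ˣ) (w : W) {H : Submodule ℂ V} (hH : H ∈ arrangement W) :
    H.map (toLin W w) ∈ arrangement W := by
  obtain ⟨t, ht, rfl⟩ := hH
  have key : (fixedSpace (t : (V →ₗ[ℂ] V)ˣ)).map (toLin W w) = fixedSpace ((w * t * w⁻¹ : W) : (V →ₗ[ℂ] V)ˣ) := by
    ext x
    rw [mem_fixedSpace W (w * t * w⁻¹)]
    constructor
    · rintro ⟨u, hu, rfl⟩
      have hu' := (mem_fixedSpace W t u).1 hu
      rw [toLin_mul_apply, toLin_inv_apply, toLin_mul_apply, hu']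
    · intro hx
      refine ⟨toLin W w⁻¹ x, (mem_fixedSpace W t _).2 ?_, toLin_apply_inv W w x⟩
      rw [toLin_mul_apply, toLin_mul_apply] at hx
      conv_rhs => rw [← hx]
      rw [toLin_inv_apply]
  refine ⟨w * t * w⁻¹, ?_, key⟩
  change Module.finrank ℂ V = Module.finrank ℂ (fixedSpace ((w * t * w⁻¹ : W) : (V →ₗ[ℂ] V)ˣ)) + 1
  rw [← key]
  have hinj : Function.Injective (toLin W w) := fun a b h => by
    rw [← toLin_inv_apply W w a, h, toLin_inv_apply]
  rw [(Submodule.equivMapOfInjective (toLin W w) hinj _).symm.finrank_eq]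
  exact ht

end WFF

open Classical in
/-- **Weighted factorization formula**: for `W` irreducible and `g` regular of
order `d` with `d·l_R(g) = |R| + |A|`, every orbit satisfies `n_C(g) = e_C·ω_C/d`,
and the number of reflection factorizations of `g` of length `N = Σ_C l(C)` using
exactly `l(C)` reflections from each orbit `C` equals
`(N!/(|W|·∏_C l(C)!))·∏_C Σ_{k=0}^{e_Cω_C/d} (−1)^k (e_Cω_C/d choose k)
(ω_C(e_C−1) − kd)^{l(C)}`. -/
theorem weighted_factorization_formula
    (V : Type*) [AddCommGroup V] [Module ℂ V] [FiniteDimensional ℂ V]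
    (W : Subgroup (V →ₗ[ℂ] V)ˣ) [Finite W]
    (hgen : Subgroup.closure (refls W) = ⊤)
    (hirr : IsIrredAction W)
    (d : ℕ) (g : W) (hg : IsRegularElt W g d)
    (lg : ℕ) (hlg : IsReflLength W g lg)
    (hdl : d * lg = (refls W).ncard + (arrangement W).ncard)
    (OC : Finset (Set (Submodule ℂ V)))
    (hOC : ∀ C, C ∈ OC ↔ ∃ H ∈ arrangement W, C = orbitOf W H)
    (eF ωF nF : Set (Submodule ℂ V) → ℕ)
    (heω : ∀ C ∈ OC, ∀ H ∈ C, (ptStab W H).ncard = eF C ∧ C.ncard = ωF C)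
    (hnF : ∀ C ∈ OC, IsMinOrbitCount W g C (nF C))
    (lfun : Set (Submodule ℂ V) → ℕ) (N : ℕ) (hN : N = ∑ C ∈ OC, lfun C) :
    (∀ C ∈ OC, d * nF C = eF C * ωF C) ∧
    (Nat.card W : ℤ) * (∏ C ∈ OC, ((lfun C).factorial : ℤ)) *
      Nat.card {t : Fin N → W // IsReflFac W g N t ∧ ∀ C ∈ OC,
        (Finset.univ.filter fun i =>
          fixedSpace (t i : (V →ₗ[ℂ] V)ˣ) ∈ C).card = lfun C} =
      (N.factorial : ℤ) * ∏ C ∈ OC,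
        ∑ k ∈ Finset.range (eF C * ωF C / d + 1),
          (-1 : ℤ) ^ k * ((eF C * ωF C / d).choose k) *
            ((ωF C : ℤ) * ((eF C : ℤ) - 1) - k * d) ^ (lfun C) := by
  have : Fintype W := Fintype.ofFinite W
  obtain ⟨hord, ζ, v, hv0, hζ, hgv, hv⟩ := hg
  have hdpos : 0 < d := hord ▸ orderOf_pos g
  -- orbit facts
  have hfin : ∀ C ∈ OC, C.Finite := by
    intro C hC
    obtain ⟨H, hH, rfl⟩ := (hOC C).1 hC
    have : orbitOf W H = Set.range (fun w : W => H.map (toLin W w)) := by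
      ext H'; exact ⟨fun ⟨w, hw⟩ => ⟨w, hw.symm⟩, fun ⟨w, hw⟩ => ⟨w, hw.symm⟩⟩
    rw [this]; exact Set.finite_range _
  have harrmap : ∀ (w : W), ∀ H ∈ arrangement W, H.map (toLin W w) ∈ arrangement W :=
    fun w H hH => WFF.arr_map W w hH
  have hCarr : ∀ C ∈ OC, ∀ H ∈ C, H ∈ arrangement W := by
    intro C hC H' hH'
    obtain ⟨H, hH, rfl⟩ := (hOC C).1 hC
    obtain ⟨w, rfl⟩ := hH'
    exact harrmap w H hH
  have hmm : ∀ (w w' : W) (H : Submodule ℂ V), (H.map (toLin W w)).map (toLin W w') = H.map (toLin W (w' * w)) := by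
    intro w w' H
    rw [← Submodule.map_comp, ← WFF.toLin_mul]
  have hself : ∀ H, H ∈ orbitOf W H := by
    intro H
    exact ⟨1, by rw [WFF.toLin_one, Submodule.map_id]⟩
  have hmap : ∀ C ∈ OC, ∀ (w : W), ∀ H ∈ C, H.map (toLin W w) ∈ C := by
    intro C hC w H' hH'
    obtain ⟨H, hH, rfl⟩ := (hOC C).1 hC
    obtain ⟨w', rfl⟩ := hH'
    exact ⟨w * w', hmm _ _ _⟩
  have horb : ∀ C ∈ OC, ∀ H ∈ C, C = orbitOf W H := by
    intro C hC H' hH'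
    obtain ⟨H, hH, rfl⟩ := (hOC C).1 hC
    obtain ⟨w', rfl⟩ := hH'
    ext H''
    constructor
    · rintro ⟨w, rfl⟩
      refine ⟨w * w'⁻¹, ?_⟩
      rw [hmm]; congr 2; group
    · rintro ⟨w, rfl⟩
      exact ⟨w * w', hmm _ _ _⟩
  have huniq : ∀ C ∈ OC, ∀ C' ∈ OC, ∀ H, H ∈ C → H ∈ C' → C = C' := by
    intro C hC C' hC' H h h'
    rw [horb C hC H h, horb C' hC' H h']
  have hex : ∀ H ∈ arrangement W, ∃ C ∈ OC, H ∈ C := by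
    intro H hH
    exact ⟨orbitOf W H, (hOC _).2 ⟨H, hH, rfl⟩, hself H⟩
  have hne : ∀ C ∈ OC, ∃ H, H ∈ C := by
    intro C hC
    obtain ⟨H, hH, rfl⟩ := (hOC C).1 hC
    exact ⟨H, hself H⟩
  have hω : ∀ C ∈ OC, C.ncard = ωF C := by
    intro C hC
    obtain ⟨H, hH⟩ := hne C hC
    exact (heω C hC H hH).2
  have he : ∀ C ∈ OC, ∀ H ∈ C, (ptStab W H).ncard = eF C := fun C hC H hH => (heω C hC H hH).1
  have hmemR : ∀ (C : Set (Submodule ℂ V)) (t : W), t ∈ WFF.Cr W C ↔ t ∈ refls W ∧ fixedSpace (t : (V →ₗ[ℂ] V)ˣ) ∈ C := by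
    intro C t
    simp [WFF.Cr]
  have hcardR : ∀ C ∈ OC, ((WFF.Cr W C).card : ℤ) = ωF C * ((eF C : ℤ) - 1) := by
    intro C hC
    rw [← hω C hC]
    exact WFF.card_Cr W C (hfin C hC) (eF C) (hCarr C hC) (hmap C hC) (he C hC)
  have hrefarr : ∀ t ∈ refls W, fixedSpace ((t : W) : (V →ₗ[ℂ] V)ˣ) ∈ arrangement W := fun t ht => ⟨t, ht, rfl⟩
  -- the index type
  let R : {C // C ∈ OC} → Finset W := fun k => WFF.Cr W k.1
  have hR : ∀ t k k', t ∈ R k → t ∈ R k' → k = k' := by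
    intro t k k' h h'
    exact Subtype.ext (huniq _ k.2 _ k'.2 _ ((hmemR _ _).1 h).2 ((hmemR _ _).1 h').2)
  have hRex : ∀ t, (∃ k, t ∈ R k) ↔ t ∈ refls W := by
    intro t
    constructor
    · rintro ⟨k, hk⟩; exact ((hmemR _ _).1 hk).1
    · intro h
      obtain ⟨C, hC, hH⟩ := hex _ (hrefarr t h)
      exact ⟨⟨C, hC⟩, (hmemR _ _).2 ⟨h, hH⟩⟩
  have hcount1 : (refls W).ncard = ∑ k, (R k).card := by
    rw [← Finset.card_biUnion]
    · rw [← Set.ncard_coe_finset]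
      congr 1
      ext t
      rw [← hRex]
      simp
    · intro k _ k' _ hne
      rw [Function.onFun, Finset.disjoint_left]
      intro t h h'
      exact hne (hR t k k' h h')
  have hcount2 : (arrangement W).ncard = ∑ k : {C // C ∈ OC}, ωF k.1 := by
    have h1 : ∀ k : {C // C ∈ OC}, ωF k.1 = ((hfin k.1 k.2).toFinset).card := by
      intro k
      rw [← hω k.1 k.2, Set.ncard_eq_toFinset_card _ (hfin k.1 k.2)]
    rw [Finset.sum_congr rfl (fun k _ => h1 k), ← Finset.card_biUnion]
    · rw [← Set.ncard_coe_finset]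
      congr 1
      ext H
      simp only [Finset.coe_biUnion, Set.mem_iUnion, Set.Finite.coe_toFinset, Finset.mem_coe, Finset.mem_univ,
        exists_true_left]
      constructor
      · intro h
        obtain ⟨C, hC, hH⟩ := hex _ h
        exact ⟨⟨C, hC⟩, hH⟩
      · rintro ⟨k, hk⟩
        exact hCarr k.1 k.2 H hk
    · intro k _ k' _ hne
      rw [Function.onFun, Finset.disjoint_left]
      intro H h h'
      rw [Set.Finite.mem_toFinset] at h h'
      exact hne (Subtype.ext (huniq _ k.2 _ k'.2 _ h h'))
  have hdl' : d * lg = ∑ k : {C // C ∈ OC}, eF k.1 * ωF k.1 := by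
    rw [hdl, hcount1, hcount2, ← Finset.sum_add_distrib]
    apply Finset.sum_congr rfl
    intro k _
    have := hcardR k.1 k.2
    have h2 : (((R k).card + ωF k.1 : ℕ) : ℤ) = ((eF k.1 * ωF k.1 : ℕ) : ℤ) := by
      push_cast
      change ((WFF.Cr W k.1).card : ℤ) + _ = _
      rw [this]; ring
    exact_mod_cast h2
  obtain ⟨n, dim, hdim, ⟨π⟩⟩ := IsSemisimpleRing.exists_algEquiv_pi_matrix_of_isAlgClosed ℂ (MonoidAlgebra ℂ W)
  have hd : ∀ i, 0 < dim i := fun i => Nat.pos_of_ne_zero (hdim i).out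
  obtain ⟨m, hm1, hm2, hm3⟩ := WFF.grp_count π hd g R (fun k => eF k.1 * ωF k.1) d hdpos ζ hζ lg hdl'
    (by
      intro n hn t ht hp
      have := hlg.2 n t ⟨fun i => (hRex _).1 (ht i), hp⟩
      omega)
    (by
      rw [← hgen]; congr 1; ext t; exact hRex t)
    (by
      intro k
      obtain ⟨Φ, c, h1, h2, h3, h4, h5, h6, h7⟩ := WFF.geo W π hd g ζ v hgv hv k.1 (hfin _ k.2) (eF k.1) (hCarr _ k.2)
        (hmap _ k.2) (he _ k.2)
      refine ⟨Φ, c, h1, h2, ?_, h4, h5, h6, ?_⟩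
      · intro i; rw [← hω k.1 k.2]; exact h3 i
      · intro k' hk' s hs i
        have hs' := (hmemR _ _).1 hs
        refine h7 s hs'.1 (fun hmem => hk' ?_) i
        exact Subtype.ext (huniq _ k'.2 _ k.2 _ hs'.2 hmem))
  have hfilt : ∀ {l : ℕ} (f : Fin l → W) (hf : ∀ i, f i ∈ refls W) (k : {C // C ∈ OC}),
      (Finset.univ.filter fun i => fixedSpace (f i : (V →ₗ[ℂ] V)ˣ) ∈ k.1).card =
      (Finset.univ.filter fun i => f i ∈ R k).card := by
    intro l f hf k
    congr 1
    ext i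
    simp only [Finset.mem_filter, Finset.mem_univ, true_and]
    rw [hmemR]
    exact ⟨fun h => ⟨hf i, h⟩, fun h => h.2⟩
  have hlow : ∀ {l : ℕ} (f : Fin l → W) (hf : IsReflFac W g l f) (k : {C // C ∈ OC}),
      m k ≤ (Finset.univ.filter fun i => f i ∈ R k).card := by
    intro l f hf k
    exact WFF.abs_b g R hR m d hm3 f (fun j => (hRex _).2 (hf.1 j)) hf.2 k
  have hnm : ∀ k : {C // C ∈ OC}, nF k.1 = m k := by
    intro k
    obtain ⟨⟨l, f, hf, hfn⟩, hmin⟩ := hnF k.1 k.2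
    apply le_antisymm
    · obtain ⟨f0, hf0⟩ := hlg.1
      have h1 := hmin lg f0 hf0
      rw [hfilt f0 hf0.1] at h1
      have hsum : ∑ k, (Finset.univ.filter fun i => f0 i ∈ R k).card = ∑ k, m k := by
        rw [hm2]
        rw [← Finset.card_biUnion]
        · conv_rhs => rw [← Finset.card_fin lg]
          congr 1
          ext i
          simp only [Finset.mem_biUnion, Finset.mem_univ, true_and, Finset.mem_filter, iff_true]
          exact (hRex _).2 (hf0.1 i)
        · intro k _ k' _ hne
          rw [Function.onFun, Finset.disjoint_left]
          intro i h h'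
          exact hne (hR _ k k' (Finset.mem_filter.1 h).2 (Finset.mem_filter.1 h').2)
      have := (Finset.sum_eq_sum_iff_of_le (fun k _ => hlow f0 hf0 k)).1 hsum.symm k (Finset.mem_univ k)
      rw [this]; exact h1
    · rw [← hfn, hfilt f hf.1]
      exact hlow f hf k
  refine ⟨?_, ?_⟩
  · intro C hC
    rw [hnm ⟨C, hC⟩]; exact hm1 ⟨C, hC⟩
  · have hmain := WFF.abs_a g R hR m d hm3 (fun k : {C // C ∈ OC} => lfun k.1)
      (by rw [hN]; exact (Finset.sum_coe_sort OC lfun).symm)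
      (Finset.univ.filter (fun t : Fin N → W => IsReflFac W g N t ∧ ∀ C ∈ OC,
        (Finset.univ.filter fun i =>
          fixedSpace (t i : (V →ₗ[ℂ] V)ˣ) ∈ C).card = lfun C))
      (by
        intro t
        rw [Finset.mem_filter]
        simp only [Finset.mem_univ, true_and, hRex, IsReflFac]
        apply and_congr_right
        intro ht
        constructor
        · intro h k
          rw [← hfilt t ht.1]; exact h k.1 k.2
        · intro h C hC
          rw [← h ⟨C, hC⟩]; exact hfilt t ht.1 ⟨C, hC⟩)
    have hsub : Nat.card {t : Fin N → W // IsReflFac W g N t ∧ ∀ C ∈ OC,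
        (Finset.univ.filter fun i =>
          fixedSpace (t i : (V →ₗ[ℂ] V)ˣ) ∈ C).card = lfun C} =
        (Finset.univ.filter (fun t : Fin N → W => IsReflFac W g N t ∧ ∀ C ∈ OC,
        (Finset.univ.filter fun i =>
          fixedSpace (t i : (V →ₗ[ℂ] V)ˣ) ∈ C).card = lfun C)).card := by
      rw [Nat.card_eq_fintype_card, Fintype.card_subtype]
    have hprod : ∀ F : Set (Submodule ℂ V) → ℤ, ∏ C ∈ OC, F C = ∏ k : {C // C ∈ OC}, F k.1 :=
      fun F => (Finset.prod_coe_sort OC F).symm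
    rw [hsub, Nat.card_eq_fintype_card, hprod, hprod]
    refine hmain.trans ?_
    congr 1
    apply Finset.prod_congr rfl
    intro k _
    have hk : eF k.1 * ωF k.1 / d = m k := by
      rw [← hm1 k, Nat.mul_div_cancel_left _ hdpos]
    rw [hk]
    have := hcardR k.1 k.2
    simp only [R, this]
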